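/- arXiv:1705.04104 — 2 statements merged into one kernel-verified Lean document; each statement's English description precedes it below -/
import Mathlib

section
/- Let A ∈ ℝ_max^{n×n}, let C_1,…,C_l be the strongly connected components of C(A) with node sets N_1,…,N_l, let A^{(1)} = A and, for ν = 2,…,l, let A^{(ν)} be obtained from A by setting to −∞ all entries whose row or column index lies in N_1 ∪ ⋯ ∪ N_{ν−1}. Let n_ν = n − |N_1 ∪ ⋯ ∪ N_{ν−1}| and let g_ν be the girth of C_ν. Then T_1(A) ≤ max_{ν=1,…,l} DM(g_ν, n_ν). -/
open scoped Classical

noncomputable section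

/-- The max-plus semiring carrier: `ℝ ∪ {-∞}`. `max` is the semiring addition `⊕`
and `+` (with `⊥` absorbing) is the semiring multiplication `⊗`. -/
abbrev Rmax : Type := WithBot ℝ

/-- Square max-plus matrices. -/
abbrev Mat (n : ℕ) : Type := Fin n → Fin n → Rmax

namespace MaxPlus

variable {n : ℕ}

/-- Entrywise max-plus sum of matrices. -/
def oplus (A B : Mat n) : Mat n := fun i j => max (A i j) (B i j)

/-- Max-plus matrix product. -/
def mul (A B : Mat n) : Mat n := fun i j => Finset.univ.sup fun k => A i k + B k j

/-- Max-plus identity matrix. -/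
def idm : Mat n := fun i j => if i = j then 0 else ⊥

/-- Max-plus matrix power. -/
def pow (A : Mat n) : ℕ → Mat n
  | 0 => idm
  | t + 1 => mul A (pow A t)

/-- The arc relation of the digraph `D(A)`. -/
def arc (A : Mat n) (i j : Fin n) : Prop := A i j ≠ ⊥

/-- `W` is a walk of the digraph with arc relation `R` (a nonempty list of nodes,
consecutive nodes joined by arcs). -/
def IsWalk (R : Fin n → Fin n → Prop) (W : List (Fin n)) : Prop := W ≠ [] ∧ W.Chain' R

/-- `W` is a walk from `i` to `j`. -/
def IsWalkFrom (R : Fin n → Fin n → Prop) (W : List (Fin n)) (i j : Fin n) : Prop :=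
  IsWalk R W ∧ W.head? = some i ∧ W.getLast? = some j

/-- The length of a walk: its number of arcs (= number of nodes minus one). -/
def len (W : List (Fin n)) : ℕ := W.length - 1

/-- The weight `p(W)` of a walk: the max-plus product (= sum) of its arc weights. -/
def weight (A : Mat n) (W : List (Fin n)) : Rmax :=
  ((W.zip W.tail).map fun p => A p.1 p.2).sum

/-- A cycle: a closed walk of positive length with no proper closed subwalk. -/
def IsCycle (R : Fin n → Fin n → Prop) (W : List (Fin n)) : Prop :=
  2 ≤ W.length ∧ W.Chain' R ∧ W.head? = W.getLast? ∧ W.dropLast.Nodup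

/-- The mean weight of a cycle: its weight divided by its length. -/
def mean (A : Mat n) (W : List (Fin n)) : Rmax :=
  (weight A W).map fun r => r / (len W : ℝ)

/-- The maximum cycle mean `λ(A)` (equal to `⊥ = -∞` if there are no cycles). -/
def lam (A : Mat n) : Rmax := sSup {m | ∃ W, IsCycle (arc A) W ∧ m = mean A W}

/-- A critical cycle: a cycle of `D(A)` attaining the maximum cycle mean. -/
def IsCritCycle (A : Mat n) (W : List (Fin n)) : Prop :=
  IsCycle (arc A) W ∧ mean A W = lam A

/-- A node of the critical graph `C(A)`. -/
def critNode (A : Mat n) (i : Fin n) : Prop := ∃ W, IsCritCycle A W ∧ i ∈ W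

/-- An arc of the critical graph `C(A)`. -/
def critArc (A : Mat n) (i j : Fin n) : Prop :=
  ∃ W, IsCritCycle A W ∧ (i, j) ∈ W.zip W.tail

/-- Reachability in the digraph with arc relation `R`. -/
def reach (R : Fin n → Fin n → Prop) (i j : Fin n) : Prop := ∃ W, IsWalkFrom R W i j

/-- `i` and `j` lie in the same strongly connected component. -/
def sameSCC (R : Fin n → Fin n → Prop) (i j : Fin n) : Prop := reach R i j ∧ reach R j i

/-- `i` lies on some cycle of the digraph. -/
def onCycle (R : Fin n → Fin n → Prop) (i : Fin n) : Prop := ∃ W, IsCycle R W ∧ i ∈ W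

/-- The girth of the strongly connected component of `i`: the minimal length of a
cycle meeting that component. -/
def girthAt (R : Fin n → Fin n → Prop) (i : Fin n) : ℕ :=
  sInf {t | ∃ W, IsCycle R W ∧ (∃ v ∈ W, sameSCC R i v) ∧ len W = t}

/-- The maximal girth of a (completely reducible) digraph: the maximum of the girths
of its strongly connected components. -/
def maxGirth (R : Fin n → Fin n → Prop) : ℕ :=
  sSup {g | ∃ i, onCycle R i ∧ girthAt R i = g}

/-- The gcd of the cycle lengths in the strongly connected component of `i`
(described as the greatest common divisor of all such cycle lengths). -/
def sccGcd (R : Fin n → Fin n → Prop) (i : Fin n) : ℕ :=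
  sSup {d | ∀ W, IsCycle R W → (∃ v ∈ W, sameSCC R i v) → d ∣ len W}

/-- The cyclicity of a (completely reducible) digraph: the lcm over its strongly
connected components of the gcds of their cycle lengths. -/
def cyclicity (R : Fin n → Fin n → Prop) : ℕ :=
  (Finset.univ.filter fun i => onCycle R i).lcm (sccGcd R)

/-- Kleene star `X^* = I ⊕ X ⊕ ⋯ ⊕ X^{n-1}`. -/
def star (A : Mat n) : Mat n := fun i j => (Finset.range n).sup fun k => pow A k i j

/-- Scalar (max-plus) multiplication of a matrix. -/
def smul (c : Rmax) (A : Mat n) : Mat n := fun i j => c + A i j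

/-- Max-plus negation (inversion) of a scalar. -/
def negB : Rmax → Rmax := WithBot.map Neg.neg

/-- The CSR term `CS^tR[A]`. -/
def csr (A : Mat n) (t : ℕ) : Mat n :=
  if lam A = ⊥ then fun _ _ => ⊥ else
    let M := star (pow (smul (negB (lam A)) A) (cyclicity (critArc A)))
    let C : Mat n := fun i j => if critNode A j then M i j else ⊥
    let S : Mat n := fun i j => if critArc A i j then A i j else ⊥
    let R : Mat n := fun i j => if critNode A i then M i j else ⊥
    mul C (mul (pow S t) R)

/-- The Nachtigall matrix `B_N`: entries with a critical index are set to `-∞`. -/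
def bN (A : Mat n) : Mat n := fun i j => if critNode A i ∨ critNode A j then ⊥ else A i j

/-- The weak CSR threshold `T₁(A) = T₁(A, B_N)`. -/
def T1 (A : Mat n) : ℕ :=
  sInf {T | ∀ t, T ≤ t → pow A t = oplus (csr A t) (pow (bN A) t)}

/-- The Dulmage–Mendelsohn bound `DM(g,n) = g(n-2) + n`. -/
def DM (g N : ℕ) : ℕ := g * (N - 2) + N

/-- The Wielandt bound `Wi(n)`. -/
def Wi (N : ℕ) : ℕ := if N = 1 then 0 else (N - 1) ^ 2 + 1

/-- The matrix `A₁` (0-indexed version of Equation (5) of the paper): it keeps the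
arcs `(i,i+1)` for `1 ≤ i ≤ n-1`, `(n,1)` and `(g,1)` of `A` (in 1-indexed terms). -/
def A1 (A : Mat n) (g : ℕ) : Mat n := fun i j =>
  if j.val = i.val + 1 ∨ (i.val = n - 1 ∧ j.val = 0) ∨ (i.val = g - 1 ∧ j.val = 0)
  then A i j else ⊥

/-- The matrix `B₁`: it keeps the arcs `(i,j)` with `i > g`, `j > g`,
`j ≡ i+1 (mod g)` (in 1-indexed terms). -/
def B1 (A : Mat n) (g : ℕ) : Mat n := fun i j =>
  if g ≤ i.val ∧ g ≤ j.val ∧ j.val % g = (i.val + 1) % g then A i j else ⊥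

/-- The matrix `A₂`: the remaining entries of `A`. -/
def A2 (A : Mat n) (g : ℕ) : Mat n := fun i j =>
  if oplus (A1 A g) (B1 A g) i j ≠ ⊥ then ⊥ else A i j

/-- Strict domination of matrices: `X < Y` entrywise, equality allowed only at `-∞`. -/
def mLt (X Y : Mat n) : Prop := ∀ i j, X i j < Y i j ∨ (X i j = ⊥ ∧ Y i j = ⊥)

/-- The cycle `1 2 ⋯ g 1` (0-indexed: the node list `[0,1,…,g-1,0]`). -/
def stdCyc (N g : ℕ) : List (Fin N) := (List.finRange N).take g ++ (List.finRange N).take 1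

/-- The node list of the walk `(g+1)⋯n(1⋯n)^g` (0-indexed). -/
def wInteresting (N g : ℕ) : List (Fin N) :=
  (List.finRange N).drop g ++ (List.replicate g (List.finRange N)).flatten

/-- The node list of the walk `n(1⋯(n-1))^{n-1}1⋯n` (0-indexed). -/
def wWielandt (N : ℕ) : List (Fin N) :=
  (List.finRange N).drop (N - 1) ++
    (List.replicate (N - 1) ((List.finRange N).take (N - 1))).flatten ++ List.finRange N

/-- Walks from `i` to `j` through a node of `Z₀` whose length is `≡ m (mod γ)`. -/
def ThroughSet (A : Mat n) (Z0 : List (Fin n)) (i j : Fin n) (γ m : ℕ) :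
    Set (List (Fin n)) :=
  {V | IsWalkFrom (arc A) V i j ∧ (∃ v ∈ V, v ∈ Z0) ∧ len V % γ = m % γ}

/-- A twice optimal walk: of minimal length among the walks of maximal weight in
`ThroughSet A Z0 i j γ m`. -/
def TwiceOpt (A : Mat n) (Z0 : List (Fin n)) (i j : Fin n) (γ m : ℕ)
    (W : List (Fin n)) : Prop :=
  W ∈ ThroughSet A Z0 i j γ m ∧
  (∀ V ∈ ThroughSet A Z0 i j γ m, weight A V ≤ weight A W) ∧
  (∀ V ∈ ThroughSet A Z0 i j γ m, weight A V = weight A W → len W ≤ len V)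

/-- An interesting walk: twice optimal (for residue `DM(g,n) - 1` modulo `g`) of
length `DM(g,n) + g - 1`. -/
def Interesting (A : Mat n) (g : ℕ) (Z0 : List (Fin n)) (i j : Fin n)
    (W : List (Fin n)) : Prop :=
  TwiceOpt A Z0 i j g (DM g n - 1) W ∧ len W = DM g n + g - 1

/-- The index of a digraph: the transient of its Boolean adjacency matrix. -/
def Tind (R : Fin n → Fin n → Prop) : ℕ :=
  sInf {T | ∀ t, T ≤ t → ∀ i j : Fin n,
    (∃ W, IsWalkFrom R W i j ∧ len W = t) ↔
      (∃ W, IsWalkFrom R W i j ∧ len W = t + cyclicity R)}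

/-- The transient of row `i` of `A`. -/
def rowTrans (A : Mat n) (i : Fin n) : ℕ :=
  sInf {T | ∀ t, T ≤ t → ∀ j, pow A t i j = csr A t i j}

/-- The transient of column `i` of `A`. -/
def colTrans (A : Mat n) (i : Fin n) : ℕ :=
  sInf {T | ∀ t, T ≤ t → ∀ j, pow A t j i = csr A t j i}

/-- The maximum of the transients of the critical rows and columns of `A`. -/
def critTransMax (A : Mat n) : ℕ :=
  (Finset.univ.filter fun i => critNode A i).sup fun i =>
    max (rowTrans A i) (colTrans A i)

/-- Renumbering of the nodes of `A` by a permutation `σ`. -/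
def renum (σ : Equiv.Perm (Fin n)) (A : Mat n) : Mat n := fun i j => A (σ i) (σ j)

end MaxPlus

namespace MaxPlus

variable {n : ℕ}

theorem le_mul_apply (X Y : Mat n) (i k j : Fin n) : X i k + Y k j ≤ mul X Y i j :=
  Finset.le_sup (f := fun k => X i k + Y k j) (Finset.mem_univ k)

theorem mul_apply_le {X Y : Mat n} {i j : Fin n} {c : Rmax} (h : ∀ k, X i k + Y k j ≤ c) :
    mul X Y i j ≤ c :=
  Finset.sup_le fun k _ => h k

theorem exists_mul_apply_eq (X Y : Mat n) (i j : Fin n) :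
    ∃ k, mul X Y i j = X i k + Y k j := by
  obtain ⟨k, -, h⟩ := Finset.exists_mem_eq_sup Finset.univ ⟨i, Finset.mem_univ i⟩
    (fun k => X i k + Y k j)
  exact ⟨k, h⟩

theorem pow_add_pow_le (X : Mat n) (a b : ℕ) (i k j : Fin n) :
    pow X a i k + pow X b k j ≤ pow X (a + b) i j := by
  induction a generalizing i with
  | zero =>
    by_cases h : i = k
    · subst h; simp [pow, idm]
    · simp [pow, idm, h]
  | succ a ih =>
    obtain ⟨l, hl⟩ := exists_mul_apply_eq X (pow X a) i k
    rw [Nat.add_right_comm]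
    change mul X (pow X a) i k + _ ≤ mul X (pow X (a + b)) i j
    rw [hl, add_assoc]
    exact (add_le_add le_rfl (ih l)).trans (le_mul_apply X _ i l j)

theorem exists_pow_add_le (X : Mat n) (a b : ℕ) (i j : Fin n) :
    ∃ k, pow X (a + b) i j ≤ pow X a i k + pow X b k j := by
  induction a generalizing i with
  | zero => exact ⟨i, by simp [pow, idm]⟩
  | succ a ih =>
    obtain ⟨l, hl⟩ := exists_mul_apply_eq X (pow X (a + b)) i j
    obtain ⟨k, hk⟩ := ih l
    refine ⟨k, ?_⟩
    rw [Nat.add_right_comm]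
    change mul X (pow X (a + b)) i j ≤ mul X (pow X a) i k + _
    rw [hl]
    refine (add_le_add le_rfl hk).trans ?_
    rw [← add_assoc]
    exact add_le_add (le_mul_apply X _ i l k) le_rfl

theorem pow_add_eq_mul (X : Mat n) (a b : ℕ) :
    pow X (a + b) = mul (pow X a) (pow X b) := by
  funext i j
  apply le_antisymm
  · obtain ⟨k, hk⟩ := exists_pow_add_le X a b i j
    exact hk.trans (le_mul_apply _ _ i k j)
  · exact Finset.sup_le fun k _ => pow_add_pow_le X a b i k j

theorem pow_pow (X : Mat n) (c m : ℕ) : pow (pow X c) m = pow X (c * m) := by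
  induction m with
  | zero => rfl
  | succ m ih => rw [Nat.mul_succ, Nat.add_comm (c * m) c, pow_add_eq_mul X c, ← ih]; rfl

theorem pow_mono {X Y : Mat n} (h : ∀ i j, X i j ≤ Y i j) (t : ℕ) (i j : Fin n) :
    pow X t i j ≤ pow Y t i j := by
  induction t generalizing i with
  | zero => exact le_rfl
  | succ t ih =>
    change mul X (pow X t) i j ≤ mul Y (pow Y t) i j
    exact mul_apply_le fun k => (add_le_add (h i k) (ih k)).trans (le_mul_apply Y _ i k j)

theorem pow_nonpos {X : Mat n} (h : ∀ i j, X i j ≤ 0) (t : ℕ) (i j : Fin n) :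
    pow X t i j ≤ 0 := by
  induction t generalizing i with
  | zero => simp only [pow, idm]; split_ifs <;> simp
  | succ t ih =>
    change mul X (pow X t) i j ≤ 0
    exact mul_apply_le fun k => add_nonpos (h i k) (ih k)

theorem pow_conj_le {X Y : Mat n} {u : Fin n → ℝ} {c : ℝ}
    (h : ∀ i j, X i j = Y i j + ((c + u i - u j : ℝ) : Rmax)) (t : ℕ) (i j : Fin n) :
    pow X t i j ≤ pow Y t i j + ((t * c + u i - u j : ℝ) : Rmax) := by
  induction t generalizing i with
  | zero => by_cases hij : i = j <;> simp [pow, idm, hij]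
  | succ t ih =>
    change mul X (pow X t) i j ≤ mul Y (pow Y t) i j + _
    refine mul_apply_le fun k => ?_
    rw [h i k]
    refine (add_le_add le_rfl (ih k)).trans ?_
    rw [add_add_add_comm, ← WithBot.coe_add]
    refine add_le_add (le_mul_apply Y _ i k j) (le_of_eq ?_)
    congr 1
    push_cast
    ring

/-- Powers of matrices that are diagonally similar up to a scalar. -/
theorem pow_conj {X Y : Mat n} {u : Fin n → ℝ} {c : ℝ}
    (h : ∀ i j, X i j = Y i j + ((c + u i - u j : ℝ) : Rmax)) (t : ℕ) (i j : Fin n) :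
    pow X t i j = pow Y t i j + ((t * c + u i - u j : ℝ) : Rmax) := by
  refine le_antisymm (pow_conj_le h t i j) ?_
  have h' : ∀ i j, Y i j = X i j + ((-c + (-u) i - (-u) j : ℝ) : Rmax) := fun i j => by
    rw [h i j, add_assoc, ← WithBot.coe_add, Pi.neg_apply, Pi.neg_apply,
      show c + u i - u j + (-c + -u i - -u j) = 0 by ring, WithBot.coe_zero, add_zero]
  refine (add_le_add (pow_conj_le h' t i j) le_rfl).trans ?_
  rw [add_assoc, ← WithBot.coe_add, Pi.neg_apply, Pi.neg_apply,
    show t * -c + -u i - -u j + (t * c + u i - u j) = 0 by ring, WithBot.coe_zero, add_zero]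

/-- The weight of the first `t` steps of the node sequence `f`. -/
def seqWeight (X : Mat n) (f : ℕ → Fin n) (t : ℕ) : Rmax :=
  ∑ s ∈ Finset.range t, X (f s) (f (s + 1))

theorem seqWeight_le_pow (X : Mat n) (f : ℕ → Fin n) (t : ℕ) :
    seqWeight X f t ≤ pow X t (f 0) (f t) := by
  induction t generalizing f with
  | zero => simp [seqWeight, pow, idm]
  | succ t ih =>
    rw [seqWeight, Finset.sum_range_succ', add_comm]
    exact (add_le_add le_rfl (ih fun s => f (s + 1))).trans (le_mul_apply X _ _ (f 1) _)

theorem exists_pow_le_seqWeight (X : Mat n) (t : ℕ) (i j : Fin n) (h : pow X t i j ≠ ⊥) :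
    ∃ f : ℕ → Fin n, f 0 = i ∧ f t = j ∧ pow X t i j ≤ seqWeight X f t := by
  induction t generalizing i with
  | zero =>
    have hij : i = j := by
      by_contra hij
      simp [pow, idm, hij] at h
    exact ⟨fun _ => i, rfl, hij, by simp [pow, idm, seqWeight, hij]⟩
  | succ t ih =>
    obtain ⟨k, hk⟩ := exists_mul_apply_eq X (pow X t) i j
    change mul X (pow X t) i j ≠ ⊥ at h
    rw [hk, ne_eq, WithBot.add_eq_bot, not_or] at h
    obtain ⟨f, h0, ht, hf⟩ := ih k h.2
    refine ⟨fun s => Nat.casesOn s i f, rfl, ht, ?_⟩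
    change mul X (pow X t) i j ≤ _
    rw [hk, seqWeight, Finset.sum_range_succ', add_comm]
    exact add_le_add hf (by simp [h0])

theorem seqWeight_add (X : Mat n) (f : ℕ → Fin n) (s t : ℕ) :
    seqWeight X f (s + t) = seqWeight X f s + seqWeight X (fun x => f (s + x)) t := by
  simp only [seqWeight, Finset.sum_range_add, Nat.add_assoc]

theorem seqWeight_congr (X : Mat n) {f f' : ℕ → Fin n} {t : ℕ}
    (h : ∀ s ≤ t, f s = f' s) : seqWeight X f t = seqWeight X f' t := by
  refine Finset.sum_congr rfl fun s hs => ?_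
  rw [Finset.mem_range] at hs
  rw [h s hs.le, h (s + 1) hs]

theorem seqWeight_nonpos {X : Mat n} (hX : ∀ i j, X i j ≤ 0) (f : ℕ → Fin n) (t : ℕ) :
    seqWeight X f t ≤ 0 :=
  Finset.sum_nonpos fun _ _ => hX _ _

/-- Skip the `d` steps after position `p`. -/
def skip (f : ℕ → Fin n) (p d : ℕ) (s : ℕ) : Fin n := if s ≤ p then f s else f (s + d)

theorem skip_of_le (f : ℕ → Fin n) {p d s : ℕ} (h : s ≤ p) : skip f p d s = f s := if_pos h

theorem skip_of_ge {f : ℕ → Fin n} {p d s : ℕ} (hf : f p = f (p + d)) (h : p ≤ s) :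
    skip f p d s = f (s + d) := by
  rcases h.eq_or_lt with rfl | h
  · rw [skip_of_le f le_rfl, hf]
  · exact if_neg (by omega)

theorem seqWeight_le_skip {X : Mat n} (hX : ∀ i j, X i j ≤ 0) {f : ℕ → Fin n} {p d : ℕ}
    (hf : f p = f (p + d)) (e : ℕ) :
    seqWeight X f (p + d + e) ≤ seqWeight X (skip f p d) (p + e) := by
  rw [seqWeight_add, seqWeight_add, seqWeight_add]
  have h1 : seqWeight X (skip f p d) p = seqWeight X f p :=
    seqWeight_congr X fun s hs => skip_of_le f hs
  have h2 : seqWeight X (fun x => skip f p d (p + x)) e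
      = seqWeight X (fun x => f (p + d + x)) e :=
    seqWeight_congr X fun s _ => by
      rw [skip_of_ge hf (Nat.le_add_right p s), Nat.add_right_comm]
  rw [h1, h2]
  exact add_le_add (add_le_of_nonpos_right (seqWeight_nonpos hX _ _)) le_rfl

theorem exists_lt_pow_le {X : Mat n} (hX : ∀ i j, X i j ≤ 0) (m : ℕ) (i j : Fin n) :
    ∃ k < n, pow X m i j ≤ pow X k i j := by
  induction m using Nat.strong_induction_on with
  | _ m ih =>
    by_cases hm : m < n
    · exact ⟨m, hm, le_rfl⟩
    by_cases hb : pow X m i j = ⊥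
    · exact ⟨0, i.pos, by rw [hb]; exact bot_le⟩
    obtain ⟨f, h0, ht, hf⟩ := exists_pow_le_seqWeight X m i j hb
    obtain ⟨x, hx, y, hy, hxy, hfxy⟩ : ∃ x ∈ Finset.range (m + 1), ∃ y ∈ Finset.range (m + 1),
        x ≠ y ∧ f x = f y :=
      Finset.exists_ne_map_eq_of_card_lt_of_maps_to (t := Finset.univ)
        (by simp only [Finset.card_univ, Fintype.card_fin, Finset.card_range]; omega)
        (fun _ _ => Finset.mem_univ _)
    wlog hlt : x < y generalizing x y
    · exact this y hy x hx hxy.symm hfxy.symm (by omega)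
    rw [Finset.mem_range] at hx hy
    obtain ⟨d, rfl⟩ := Nat.exists_eq_add_of_le hlt.le
    obtain ⟨e, rfl⟩ := Nat.exists_eq_add_of_le (Nat.lt_succ_iff.mp hy)
    obtain ⟨k, hk, hle⟩ := ih (x + e) (by omega)
    refine ⟨k, hk, (hf.trans (seqWeight_le_skip hX hfxy e)).trans (le_trans ?_ hle)⟩
    have := seqWeight_le_pow X (skip f x d) (x + e)
    rwa [skip_of_le f (Nat.zero_le x), skip_of_ge hfxy (Nat.le_add_right x e), h0,
      Nat.add_right_comm x e, ht] at this

theorem mem_of_seqWeight_ne_bot {X : Mat n} {U : Finset (Fin n)}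
    (hXU : ∀ i j, X i j ≠ ⊥ → i ∈ U ∧ j ∈ U) {f : ℕ → Fin n} {t q : ℕ} (hq : q ≤ t)
    (hfq : f q ∈ U) (h : seqWeight X f t ≠ ⊥) {s : ℕ} (hs : s ≤ t) : f s ∈ U := by
  have harc : ∀ x < t, f x ∈ U ∧ f (x + 1) ∈ U := fun x hx => by
    refine hXU _ _ fun hb => h ?_
    exact WithBot.sum_eq_bot_iff.2 ⟨x, Finset.mem_range.2 hx, hb⟩
  rcases hs.lt_or_eq with hs | rfl
  · exact (harc s hs).1
  · rcases Nat.eq_zero_or_pos s with rfl | hpos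
    · rwa [Nat.le_zero.1 hq] at hfq
    · have := (harc (s - 1) (by omega)).2
      rwa [Nat.sub_add_cancel hpos] at this

/-- `f` is a node sequence from `i` to `j` of weight at least `w`, whose length `t` has the
same residue as `m` modulo `g`, and which visits `Z` at position `q`. -/
structure IsVia (X : Mat n) (Z : Finset (Fin n)) (i j : Fin n) (w : Rmax) (g m : ℕ)
    (f : ℕ → Fin n) (t q : ℕ) : Prop where
  head : f 0 = i
  last : f t = j
  le_length : q ≤ t
  mem : f q ∈ Z
  modEq : t ≡ m [MOD g]
  le_weight : w ≤ seqWeight X f t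

section Reduction

variable {X : Mat n} {Z : Finset (Fin n)} {i j : Fin n} {w : Rmax} {g m : ℕ}
  {f : ℕ → Fin n} {t q : ℕ}

/-- Two closed subsequences, one on either side of the distinguished position, can be removed
if their total length is divisible by `g`. -/
theorem IsVia.exists_shorter (hX : ∀ i j, X i j ≤ 0) (h : IsVia X Z i j w g m f t q)
    {x d y e : ℕ} (hx : x + d ≤ q) (hfx : f x = f (x + d)) (hy : q ≤ y) (hye : y + e ≤ t)
    (hfy : f y = f (y + e)) (hg : g ∣ d + e) :
    ∃ f' q', IsVia X Z i j w g m f' (t - (d + e)) q' := by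
  obtain ⟨r, rfl⟩ := Nat.exists_eq_add_of_le hye
  obtain ⟨r', rfl⟩ := Nat.exists_eq_add_of_le (hx.trans hy)
  set F := skip f (x + d + r') e with hF
  have hFx : F x = F (x + d) := by
    rw [hF, skip_of_le f (by omega), skip_of_le f (by omega), hfx]
  refine ⟨skip F x d, q - d, ?_, ?_, by omega, ?_, ?_, ?_⟩
  · rw [skip_of_le F (Nat.zero_le _), hF, skip_of_le f (Nat.zero_le _), h.head]
  · rw [skip_of_ge hFx (by omega), hF, skip_of_ge hfy (by omega), ← h.last]
    congr 1
    omega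
  · rw [skip_of_ge hFx (by omega), Nat.sub_add_cancel (by omega), hF, skip_of_le f hy]
    exact h.mem
  · refine Nat.ModEq.trans ?_ h.modEq
    exact (Nat.modEq_iff_dvd' (Nat.sub_le _ _)).2
      (by rwa [Nat.sub_sub_self (by omega)])
  · refine h.le_weight.trans ((seqWeight_le_skip hX hfy r).trans ?_)
    rw [Nat.add_assoc (x + d)]
    refine (seqWeight_le_skip hX hFx (r' + r)).trans (le_of_eq ?_)
    congr 1
    omega

theorem IsVia.eq_zero_of_minimal (h : IsVia X Z i j w g m f t q)
    (hmin : ∀ f' t' q', IsVia X Z i j w g m f' t' q' → t ≤ t') (hX : ∀ i j, X i j ≤ 0)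
    {x d y e : ℕ} (hx : x + d ≤ q) (hfx : f x = f (x + d)) (hy : q ≤ y) (hye : y + e ≤ t)
    (hfy : f y = f (y + e)) (hg : g ∣ d + e) : d + e = 0 := by
  obtain ⟨f', q', h'⟩ := h.exists_shorter hX hx hfx hy hye hfy hg
  have := hmin _ _ _ h'
  omega

/-- The positions at which `f` visits `v` up to time `t`. -/
def visits (f : ℕ → Fin n) (t : ℕ) (v : Fin n) : Finset ℕ :=
  (Finset.range (t + 1)).filter fun s => f s = v

theorem mem_visits {v : Fin n} {s : ℕ} : s ∈ visits f t v ↔ s ≤ t ∧ f s = v := by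
  simp [visits]

theorem IsVia.eq_of_le_position (h : IsVia X Z i j w g m f t q)
    (hmin : ∀ f' t' q', IsVia X Z i j w g m f' t' q' → t ≤ t') (hX : ∀ i j, X i j ≤ 0)
    {a b : ℕ} (hab : a ≤ b) (hb : b ≤ q) (hf : f a = f b) (hg : a ≡ b [MOD g]) : a = b := by
  have := h.eq_zero_of_minimal hmin hX (x := a) (d := b - a) (y := q) (e := 0) (by omega)
    (by rw [hf]; congr 1; omega) le_rfl h.le_length rfl ((Nat.modEq_iff_dvd' hab).1 hg)
  omega

theorem IsVia.eq_of_position_le (h : IsVia X Z i j w g m f t q)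
    (hmin : ∀ f' t' q', IsVia X Z i j w g m f' t' q' → t ≤ t') (hX : ∀ i j, X i j ≤ 0)
    {a b : ℕ} (hab : a ≤ b) (hq : q ≤ a) (hb : b ≤ t) (hf : f a = f b)
    (hg : a ≡ b [MOD g]) : a = b := by
  have := h.eq_zero_of_minimal hmin hX (x := 0) (d := 0) (y := a) (e := b - a) (Nat.zero_le _)
    rfl hq (by omega) (by rw [hf]; congr 1; omega)
    (by rw [Nat.zero_add]; exact (Nat.modEq_iff_dvd' hab).1 hg)
  omega

theorem card_le_of_injOn_mod {S : Finset ℕ} {φ : ℕ → ℕ} (hg : 0 < g)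
    (hφ : ∀ a ∈ S, ∀ b ∈ S, a ≤ b → φ a ≡ φ b [MOD g] → a = b) : S.card ≤ g := by
  rw [← Finset.card_range g]
  refine Finset.card_le_card_of_injOn (fun s => φ s % g)
    (fun s _ => Finset.mem_coe.2 (Finset.mem_range.2 (Nat.mod_lt _ hg))) fun a ha b hb hab => ?_
  rcases le_total a b with h | h
  · exact hφ a ha b hb h hab
  · exact (hφ b hb a ha h hab.symm).symm

theorem IsVia.card_visits_le_of_mem (h : IsVia X Z i j w g m f t q)
    (hmin : ∀ f' t' q', IsVia X Z i j w g m f' t' q' → t ≤ t') (hX : ∀ i j, X i j ≤ 0)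
    (hg : 0 < g) {v : Fin n} (hv : v ∈ Z) : (visits f t v).card ≤ g := by
  refine card_le_of_injOn_mod (φ := id) hg fun a ha b hb hab hmod => ?_
  rw [mem_visits] at ha hb
  have h' : IsVia X Z i j w g m f t a := { h with le_length := ha.1, mem := ha.2 ▸ hv }
  exact h'.eq_of_position_le hmin hX hab le_rfl hb.1 (ha.2.trans hb.2.symm) hmod

theorem IsVia.card_visits_le (h : IsVia X Z i j w g m f t q)
    (hmin : ∀ f' t' q', IsVia X Z i j w g m f' t' q' → t ≤ t') (hX : ∀ i j, X i j ≤ 0)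
    (hg : 0 < g) (v : Fin n) : (visits f t v).card ≤ g + 1 := by
  by_cases hP : ∃ a ∈ visits f t v, a ≤ q
  swap
  · push Not at hP
    refine (card_le_of_injOn_mod (φ := id) hg fun a ha b hb hab hmod => ?_).trans g.le_succ
    have hqa := hP a ha
    rw [mem_visits] at ha hb
    exact h.eq_of_position_le hmin hX hab hqa.le hb.1 (ha.2.trans hb.2.symm) hmod
  by_cases hQ : ∃ a ∈ visits f t v, q < a
  swap
  · push Not at hQ
    refine (card_le_of_injOn_mod (φ := id) hg fun a ha b hb hab hmod => ?_).trans g.le_succ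
    have hbq := hQ b hb
    rw [mem_visits] at ha hb
    exact h.eq_of_le_position hmin hX hab hbq (ha.2.trans hb.2.symm) hmod
  obtain ⟨p, ⟨hp, hpq⟩, hpmax⟩ : ∃ p, (p ∈ visits f t v ∧ p ≤ q) ∧
      ∀ a ∈ visits f t v, a ≤ q → a ≤ p := by
    obtain ⟨a, ha, haq⟩ := hP
    have hne : ((visits f t v).filter (· ≤ q)).Nonempty := ⟨a, Finset.mem_filter.2 ⟨ha, haq⟩⟩
    exact ⟨Finset.max' _ hne, Finset.mem_filter.1 (Finset.max'_mem _ hne),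
      fun b hb hbq => Finset.le_max' _ _ (Finset.mem_filter.2 ⟨hb, hbq⟩)⟩
  obtain ⟨c, ⟨hc, hqc⟩, hcmin⟩ : ∃ c, (c ∈ visits f t v ∧ q < c) ∧
      ∀ a ∈ visits f t v, q < a → c ≤ a := by
    obtain ⟨a, ha, haq⟩ := hQ
    have hne : ((visits f t v).filter (q < ·)).Nonempty := ⟨a, Finset.mem_filter.2 ⟨ha, haq⟩⟩
    exact ⟨Finset.min' _ hne, Finset.mem_filter.1 (Finset.min'_mem _ hne),
      fun b hb hbq => Finset.min'_le _ _ (Finset.mem_filter.2 ⟨hb, hbq⟩)⟩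
  suffices H : ((visits f t v).erase c).card ≤ g by
    rw [Finset.card_erase_of_mem hc] at H
    omega
  -- collapse the gap between the last visit before `q` and the first visit after `q`
  refine card_le_of_injOn_mod (φ := fun s => if s ≤ q then s else s - (c - p)) hg
    fun a ha b hb hab hmod => ?_
  rw [Finset.mem_erase] at ha hb
  obtain ⟨hac, ha⟩ := ha
  obtain ⟨hbc, hb⟩ := hb
  have hpa := hpmax a ha
  have hca := hcmin a ha
  have hcb := hcmin b hb
  rw [mem_visits] at ha hb hp hc
  by_cases hbq : b ≤ q
  · simp only [hbq, hab.trans hbq, if_true] at hmod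
    exact h.eq_of_le_position hmin hX hab hbq (ha.2.trans hb.2.symm) hmod
  by_cases haq : a ≤ q
  · simp only [hbq, haq, if_true, if_false] at hmod
    have := h.eq_zero_of_minimal hmin hX (x := a) (d := p - a) (y := c) (e := b - c) (by omega)
      (by rw [Nat.add_sub_cancel' (hpa haq), ha.2, hp.2]) hqc.le (by omega)
      (by rw [Nat.add_sub_cancel' (hcb (by omega)), hb.2, hc.2])
      (by
        have := (Nat.modEq_iff_dvd' (by omega)).1 hmod
        convert this using 1
        have := hpa haq
        have := hcb (by omega)
        omega)
    have := hcb (by omega)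
    omega
  · simp only [hbq, haq, if_false] at hmod
    refine h.eq_of_position_le hmin hX hab (by omega) hb.1 (ha.2.trans hb.2.symm) ?_
    have := hmod.add_right (c - p)
    rwa [Nat.sub_add_cancel (by omega), Nat.sub_add_cancel (by omega)] at this

/-- Cycle removal: a node sequence visiting a set `Z` of at least `g` nodes can be replaced by one
of at most `(g + 1) * |U| - g - 1` steps, without decreasing its weight or changing its length
modulo `g`. -/
theorem exists_short_isVia {U : Finset (Fin n)} (hX : ∀ i j, X i j ≤ 0)
    (hXU : ∀ i j, X i j ≠ ⊥ → i ∈ U ∧ j ∈ U) (hZU : Z ⊆ U) (hg : 0 < g) (hgZ : g ≤ Z.card)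
    (hw : w ≠ ⊥) (h : IsVia X Z i j w g m f t q) :
    ∃ f' t' q', IsVia X Z i j w g m f' t' q' ∧ t' + g + 1 ≤ g * U.card + U.card := by
  have hex : ∃ t f q, IsVia X Z i j w g m f t q := ⟨t, f, q, h⟩
  obtain ⟨f', q', h'⟩ := Nat.find_spec hex
  set t' := Nat.find hex
  have hmin : ∀ f₁ t₁ q₁, IsVia X Z i j w g m f₁ t₁ q₁ → t' ≤ t₁ :=
    fun f₁ t₁ q₁ h₁ => Nat.find_min' hex ⟨f₁, q₁, h₁⟩
  refine ⟨f', t', q', h', ?_⟩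
  have hne : seqWeight X f' t' ≠ ⊥ := ne_bot_of_le_ne_bot hw h'.le_weight
  have hcard : t' + 1 = ∑ v ∈ U, (visits f' t' v).card := by
    rw [← Finset.card_range (t' + 1)]
    refine Finset.card_eq_sum_card_fiberwise fun s hs => ?_
    have hs' : s < t' + 1 := Finset.mem_range.1 (Finset.mem_coe.1 hs)
    exact mem_of_seqWeight_ne_bot hXU h'.le_length (hZU h'.mem) hne (Nat.lt_succ_iff.1 hs')
  have hZ : ∑ v ∈ Z, (visits f' t' v).card ≤ Z.card * g := by
    rw [← smul_eq_mul]
    exact Finset.sum_le_card_nsmul _ _ _ fun v hv => h'.card_visits_le_of_mem hmin hX hg hv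
  have hUZ : ∑ v ∈ U \ Z, (visits f' t' v).card ≤ (U \ Z).card * (g + 1) := by
    rw [← smul_eq_mul]
    exact Finset.sum_le_card_nsmul _ _ _ fun v _ => h'.card_visits_le hmin hX hg v
  rw [← Finset.sum_sdiff hZU] at hcard
  have hcU := Finset.card_sdiff_add_card_eq_card hZU
  rw [← hcU]
  nlinarith

end Reduction

/-- There is a walk of length `t` from `i` to `j` in the digraph with arc relation `R`. -/
inductive HasWalk (R : Fin n → Fin n → Prop) : Fin n → Fin n → ℕ → Prop
  | refl (i : Fin n) : HasWalk R i i 0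
  | step {i k j : Fin n} {t : ℕ} : R i k → HasWalk R k j t → HasWalk R i j (t + 1)

section Walks

variable {R : Fin n → Fin n → Prop} {i j k : Fin n} {a b t : ℕ}

theorem HasWalk.trans (h : HasWalk R i k a) (h' : HasWalk R k j b) :
    HasWalk R i j (a + b) := by
  induction h with
  | refl => rwa [Nat.zero_add]
  | step hr _ ih => rw [Nat.add_right_comm]; exact (ih h').step hr

theorem HasWalk.repeat (h : HasWalk R i i a) (m : ℕ) : HasWalk R i i (m * a) := by
  induction m with
  | zero => rw [Nat.zero_mul]; exact .refl i
  | succ m ih => rw [Nat.succ_mul]; exact ih.trans h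

theorem HasWalk.of_closed {P : Fin n → Prop} (h : HasWalk R i j t)
    (hP : ∀ x y, P x → R x y → P y) (hi : P i) :
    HasWalk (fun x y => R x y ∧ P x ∧ P y) i j t := by
  induction h with
  | refl => exact .refl _
  | step hr _ ih => exact (ih (hP _ _ hi hr)).step ⟨hr, hi, hP _ _ hi hr⟩

theorem HasWalk.pow_nonneg {X : Mat n} (h : HasWalk R i j t)
    (hX : ∀ x y, R x y → 0 ≤ X x y) : 0 ≤ pow X t i j := by
  induction h with
  | refl => simp [pow, idm]
  | step hr _ ih => exact (add_nonneg (hX _ _ hr) ih).trans (le_mul_apply X _ _ _ _)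

theorem HasWalk.split (h : HasWalk R i j (a + b)) :
    ∃ k, HasWalk R i k a ∧ HasWalk R k j b := by
  induction a generalizing i with
  | zero => exact ⟨i, .refl i, by rwa [Nat.zero_add] at h⟩
  | succ a ih =>
    rw [Nat.add_right_comm] at h
    cases h with
    | step hr h' =>
      obtain ⟨k, h1, h2⟩ := ih h'
      exact ⟨k, h1.step hr, h2⟩

theorem hasWalk_of_isChain {l : List (Fin n)} (h : (i :: l).IsChain R)
    (hlast : (i :: l).getLast? = some j) : HasWalk R i j l.length := by
  induction l generalizing i with
  | nil =>
    obtain rfl : i = j := by simpa using hlast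
    exact .refl i
  | cons k l ih =>
    rw [List.isChain_cons_cons] at h
    exact (ih h.2 (by simpa using hlast)).step h.1

theorem reach_iff : reach R i j ↔ ∃ t, HasWalk R i j t := by
  constructor
  · rintro ⟨W, ⟨hne, hchain⟩, hhead, hlast⟩
    cases W with
    | nil => exact absurd rfl hne
    | cons a l =>
      obtain rfl : a = i := by simpa using hhead
      exact ⟨_, hasWalk_of_isChain hchain hlast⟩
  · rintro ⟨t, h⟩
    induction h with
    | refl i => exact ⟨[i], ⟨by simp, List.isChain_singleton i⟩, rfl, rfl⟩
    | @step i k j t hr _ ih =>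
      obtain ⟨W, ⟨hne, hchain⟩, hhead, hlast⟩ := ih
      cases W with
      | nil => exact absurd rfl hne
      | cons a l =>
        obtain rfl : a = k := by simpa using hhead
        exact ⟨i :: a :: l, ⟨by simp, List.isChain_cons_cons.2 ⟨hr, hchain⟩⟩, rfl,
          by simpa using hlast⟩

theorem reach.trans (h : reach R i k) (h' : reach R k j) : reach R i j := by
  obtain ⟨a, h⟩ := reach_iff.1 h
  obtain ⟨b, h'⟩ := reach_iff.1 h'
  exact reach_iff.2 ⟨_, h.trans h'⟩

theorem sameSCC.trans (h : sameSCC R i k) (h' : sameSCC R k j) : sameSCC R i j :=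
  ⟨h.1.trans h'.1, h'.2.trans h.2⟩

theorem sameSCC_refl (R : Fin n → Fin n → Prop) (i : Fin n) : sameSCC R i i :=
  ⟨reach_iff.2 ⟨0, .refl i⟩, reach_iff.2 ⟨0, .refl i⟩⟩

variable {W : List (Fin n)} {v w : Fin n}

theorem IsCycle.len_pos (h : IsCycle R W) : 0 < len W := by
  have := h.1
  unfold len
  omega

/-- Every node of a closed chain splits it into walks to and from the base node. -/
theorem IsCycle.exists_walks (h : IsCycle R W) : ∃ r, W.head? = some r ∧ ∀ v ∈ W,
    ∃ a b, HasWalk R r v a ∧ HasWalk R v r b ∧ a + b = len W := by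
  obtain ⟨hlen, hchain, hclosed, -⟩ := h
  cases W with
  | nil => simp at hlen
  | cons r l =>
    refine ⟨r, rfl, fun v hv => ?_⟩
    obtain ⟨l₁, l₂, hl⟩ := List.append_of_mem hv
    have hchain' : (l₁ ++ v :: l₂).IsChain R := hl ▸ hchain
    rw [List.isChain_split] at hchain'
    have hlast : (v :: l₂).getLast? = some r := by
      have : (r :: l).getLast? = some r := by rw [← hclosed]; rfl
      rw [hl] at this
      simpa using this
    have hb := hasWalk_of_isChain hchain'.2 hlast
    have hlen' : l.length = l₁.length + l₂.length := by
      have := congrArg List.length hl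
      simp at this
      omega
    refine ⟨l₁.length, l₂.length, ?_, hb, by simp [len, hlen']⟩
    cases l₁ with
    | nil =>
      obtain rfl : r = v := by simpa using congrArg List.head? hl
      exact .refl _
    | cons x l₁ =>
      obtain rfl : r = x := by simpa using congrArg List.head? hl
      have := hasWalk_of_isChain (i := r) (l := l₁ ++ [v]) (j := v) hchain'.1
        (List.getLast?_concat (l := r :: l₁))
      simpa using this

theorem IsCycle.hasWalk_self (h : IsCycle R W) (hv : v ∈ W) : HasWalk R v v (len W) := by
  obtain ⟨r, -, hr⟩ := h.exists_walks
  obtain ⟨a, b, ha, hb, hab⟩ := hr v hv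
  rw [← hab, Nat.add_comm]
  exact hb.trans ha

theorem IsCycle.sameSCC (h : IsCycle R W) (hv : v ∈ W) (hw : w ∈ W) : sameSCC R v w := by
  obtain ⟨r, -, hr⟩ := h.exists_walks
  obtain ⟨a, b, ha, hb, -⟩ := hr v hv
  obtain ⟨a', b', ha', hb', -⟩ := hr w hw
  exact ⟨reach_iff.2 ⟨_, hb.trans ha'⟩, reach_iff.2 ⟨_, hb'.trans ha⟩⟩

theorem IsCycle.len_le_card (h : IsCycle R W) : len W ≤ W.toFinset.card := by
  calc len W = W.dropLast.toFinset.card := by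
        rw [List.toFinset_card_of_nodup h.2.2.2, List.length_dropLast, len]
    _ ≤ W.toFinset.card := Finset.card_le_card fun x hx => by
        rw [List.mem_toFinset] at hx ⊢
        exact List.mem_of_mem_dropLast hx

theorem IsCycle.of_zip {R' : Fin n → Fin n → Prop} (h : IsCycle R W)
    (hR : ∀ p ∈ W.zip W.tail, R' p.1 p.2) : IsCycle R' W := by
  obtain ⟨h1, -, h3, h4⟩ := h
  refine ⟨h1, ?_, h3, h4⟩
  clear h1 h3 h4
  change W.IsChain R'
  induction W with
  | nil => exact .nil
  | cons a l ih =>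
    cases l with
    | nil => exact .singleton _
    | cons b l =>
      refine List.isChain_cons_cons.2 ⟨hR (a, b) (by simp), ih fun p hp => hR p ?_⟩
      exact List.mem_cons_of_mem _ hp

theorem sccGcd_pos_and_dvd (hk : onCycle R k) : 0 < sccGcd R k ∧
    ∀ d, (∀ W, IsCycle R W → (∃ v ∈ W, MaxPlus.sameSCC R k v) → d ∣ len W) → d ∣ sccGcd R k := by
  obtain ⟨W, hW, hkW⟩ := hk
  have hkW' : ∃ v ∈ W, MaxPlus.sameSCC R k v := ⟨k, hkW, sameSCC_refl R k⟩
  set D := {d | ∀ W, IsCycle R W → (∃ v ∈ W, MaxPlus.sameSCC R k v) → d ∣ len W}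
  have hbdd : BddAbove D := ⟨len W, fun d hd => Nat.le_of_dvd hW.len_pos (hd W hW hkW')⟩
  have hmem : sccGcd R k ∈ D := Nat.sSup_mem ⟨1, fun _ _ _ => one_dvd _⟩ hbdd
  refine ⟨Nat.pos_of_dvd_of_pos (hmem W hW hkW') hW.len_pos, fun d hd => ?_⟩
  have hlcm : Nat.lcm d (sccGcd R k) ∈ D :=
    fun W hW hv => Nat.lcm_dvd (hd W hW hv) (hmem W hW hv)
  have heq := Nat.le_antisymm (le_csSup hbdd hlcm) (Nat.le_of_dvd
    (Nat.pos_of_dvd_of_pos (hlcm W hW hkW') hW.len_pos) (Nat.dvd_lcm_right d (sccGcd R k)))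
  exact (Nat.dvd_lcm_left d (sccGcd R k)).trans heq.dvd

/-- Modulo any `g > 0`, every multiple of the cyclicity of a strongly connected component is
the length of a closed walk through a given node. -/
theorem exists_hasWalk_modEq (hk : onCycle R k) {g : ℕ} (hg : 0 < g) {z : ℤ}
    (hz : (sccGcd R k : ℤ) ∣ z) : ∃ t, HasWalk R k k t ∧ (t : ℤ) ≡ z [ZMOD g] := by
  let H : AddSubgroup ℤ :=
    { carrier := {z | ∃ t, HasWalk R k k t ∧ (t : ℤ) ≡ z [ZMOD g]}
      zero_mem' := ⟨0, .refl k, by simp⟩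
      add_mem' := by
        rintro x y ⟨a, ha, hax⟩ ⟨b, hb, hby⟩
        exact ⟨a + b, ha.trans hb, by push_cast; exact hax.add hby⟩
      neg_mem' := by
        rintro x ⟨a, ha, hax⟩
        refine ⟨(g - 1) * a, ha.repeat _, ?_⟩
        rw [Nat.cast_mul, Nat.cast_pred hg]
        refine Int.ModEq.trans ?_ hax.neg
        rw [Int.modEq_iff_dvd]
        exact ⟨-a, by ring⟩ }
  obtain ⟨c, hc⟩ := Int.subgroup_cyclic H
  have hmem : ∀ x, x ∈ H ↔ c ∣ x := fun x => by
    rw [hc, ← AddSubgroup.zmultiples_eq_closure, Int.mem_zmultiples_iff]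
  have hcyc : ∀ W, IsCycle R W → (∃ v ∈ W, MaxPlus.sameSCC R k v) → c.natAbs ∣ len W := by
    rintro W hW ⟨v, hv, hkv, hvk⟩
    obtain ⟨a, ha⟩ := reach_iff.1 hkv
    obtain ⟨b, hb⟩ := reach_iff.1 hvk
    have h1 : ((a + b : ℕ) : ℤ) ∈ H := ⟨_, ha.trans hb, Int.ModEq.refl _⟩
    have h2 : ((a + len W + b : ℕ) : ℤ) ∈ H :=
      ⟨_, (ha.trans (hW.hasWalk_self hv)).trans hb, Int.ModEq.refl _⟩
    have h3 := H.sub_mem h2 h1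
    rw [← Int.natCast_dvd_natCast, Int.natAbs_dvd, ← hmem]
    convert h3 using 1
    push_cast
    ring
  have := (sccGcd_pos_and_dvd hk).2 _ hcyc
  exact (hmem z).2 ((Int.natAbs_dvd.1 (Int.natCast_dvd_natCast.2 this)).trans hz)

theorem sccGcd_dvd_cyclicity (hk : onCycle R k) : sccGcd R k ∣ cyclicity R :=
  Finset.dvd_lcm (Finset.mem_filter.2 ⟨Finset.mem_univ k, hk⟩)

theorem cyclicity_pos (R : Fin n → Fin n → Prop) : 0 < cyclicity R := by
  refine Nat.pos_of_ne_zero fun h => ?_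
  obtain ⟨k, hk, h0⟩ := (Finset.lcm_eq_zero_iff ..).1 h
  exact (sccGcd_pos_and_dvd (Finset.mem_filter.1 hk).2).1.ne' h0

theorem exists_cycle_len_eq_girthAt (hk : onCycle R k) :
    ∃ W, IsCycle R W ∧ (∃ v ∈ W, MaxPlus.sameSCC R k v) ∧ len W = girthAt R k := by
  obtain ⟨W, hW, hkW⟩ := hk
  exact Nat.sInf_mem
    (s := {t | ∃ W, IsCycle R W ∧ (∃ v ∈ W, MaxPlus.sameSCC R k v) ∧ len W = t})
    ⟨len W, W, hW, ⟨k, hkW, sameSCC_refl R k⟩, rfl⟩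

end Walks

section Weights

variable {X Y : Mat n} {u : Fin n → ℝ} {c : ℝ}

theorem weight_cons_cons (X : Mat n) (i j : Fin n) (l : List (Fin n)) :
    weight X (i :: j :: l) = X i j + weight X (j :: l) := rfl

theorem weight_append (X : Mat n) (l₁ : List (Fin n)) (i : Fin n) (l₂ : List (Fin n)) :
    weight X (l₁ ++ i :: l₂) = weight X (l₁ ++ [i]) + weight X (i :: l₂) := by
  induction l₁ with
  | nil => exact (zero_add (weight X (i :: l₂))).symm
  | cons a l ih =>
    cases l with
    | nil => simp [weight]
    | cons b l =>
      simp only [List.cons_append, weight_cons_cons] at ih ⊢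
      rw [ih, add_assoc]

theorem weight_ne_bot_iff (X : Mat n) (W : List (Fin n)) :
    weight X W ≠ ⊥ ↔ W.IsChain (arc X) := by
  induction W with
  | nil => simp [weight]
  | cons i l ih =>
    cases l with
    | nil => simp [weight]
    | cons j l =>
      rw [weight_cons_cons, ne_eq, WithBot.add_eq_bot, not_or, List.isChain_cons_cons, ← ih]
      rfl

theorem weight_conj (h : ∀ i j, X i j = Y i j + ((c + u i - u j : ℝ) : Rmax)) {i j : Fin n}
    {W : List (Fin n)} (hi : W.head? = some i) (hj : W.getLast? = some j) :
    weight X W = weight Y W + ((len W * c + u i - u j : ℝ) : Rmax) := by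
  induction W generalizing i with
  | nil => simp at hi
  | cons a l ih =>
    obtain rfl : a = i := by simpa using hi
    cases l with
    | nil =>
      obtain rfl : a = j := by simpa using hj
      simp [weight, len]
    | cons b l =>
      rw [weight_cons_cons, weight_cons_cons, h a b, ih rfl (by simpa using hj),
        add_add_add_comm, ← WithBot.coe_add]
      congr 2
      simp only [len, List.length_cons, Nat.add_sub_cancel]
      push_cast
      ring

/-- If no cycle has positive weight, then there is a finite potential. -/
theorem exists_potential (h : ∀ W, IsCycle (arc X) W → weight X W ≤ 0) :
    ∃ u : Fin n → ℝ, ∀ i j, X i j + (u j : Rmax) ≤ (u i : Rmax) := by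
  let φ : Fin n → {l : List (Fin n) // l.Nodup} → Rmax :=
    fun i l => if l.1.head? = some i then weight X l.1 else ⊥
  let U : Fin n → Rmax := fun i => Finset.univ.sup (φ i)
  have hle : ∀ i (l : List (Fin n)), l.Nodup → l.head? = some i → weight X l ≤ U i := by
    intro i l hl hi
    have := Finset.le_sup (f := φ i) (Finset.mem_univ ⟨l, hl⟩)
    simpa only [φ, hi, if_true] using this
  have hU : ∀ i, 0 ≤ U i := fun i => by
    have := hle i [i] (List.nodup_singleton i) rfl
    simpa [weight] using this
  have hpot : ∀ i j, X i j + U j ≤ U i := by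
    intro i j
    obtain ⟨⟨l, hl⟩, -, hlj⟩ := Finset.exists_mem_eq_sup Finset.univ
      ⟨⟨[i], List.nodup_singleton i⟩, Finset.mem_univ _⟩ (φ j)
    change U j = _ at hlj
    simp only [φ] at hlj
    split_ifs at hlj with hhead
    swap
    · exact absurd (hU j) (by rw [hlj]; simp)
    by_cases hil : i ∈ l
    · have hsplit : ∃ l₁ l₂, l = l₁ ++ i :: l₂ := List.append_of_mem hil
      obtain ⟨l₁, l₂, rfl⟩ := hsplit
      have hcyc : weight X (i :: (l₁ ++ [i])) ≤ 0 := by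
        by_cases hc : (i :: (l₁ ++ [i])).IsChain (arc X)
        · refine h _ ⟨by simp, hc, ?_, ?_⟩
          · exact (List.getLast?_concat (l := i :: l₁)).symm
          · rw [← List.cons_append, List.dropLast_concat]
            rw [← List.singleton_append, ← List.append_assoc] at hl
            refine (List.nodup_append_comm.1 (hl.sublist (List.sublist_append_left _ _)) :)
        · have := (weight_ne_bot_iff X _).not.2 hc
          rw [not_not] at this
          rw [this]
          exact bot_le
      have hw : X i j + weight X (l₁ ++ i :: l₂)
          = weight X (i :: (l₁ ++ [i])) + weight X (i :: l₂) := by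
        rw [← List.cons_append, ← weight_append, List.cons_append]
        obtain ⟨l', hl'⟩ : ∃ l', l₁ ++ i :: l₂ = j :: l' := by
          cases hq : l₁ ++ i :: l₂ with
          | nil => simp at hq
          | cons a l' =>
            rw [hq] at hhead
            exact ⟨l', by simpa using hhead⟩
        rw [hl', weight_cons_cons]
      rw [hlj, hw]
      exact (add_le_of_nonpos_left hcyc).trans
        (hle i _ (hl.sublist (List.sublist_append_right _ _)) rfl)
    · cases l with
      | nil => simp at hhead
      | cons a l =>
        obtain rfl : a = j := by simpa using hhead
        rw [hlj, ← weight_cons_cons]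
        exact hle i _ (List.nodup_cons.2 ⟨hil, hl⟩) rfl
  have hne : ∀ i, ∃ x : ℝ, (x : Rmax) = U i := fun i =>
    WithBot.ne_bot_iff_exists.1 (ne_bot_of_le_ne_bot WithBot.zero_ne_bot (hU i))
  choose u hu using hne
  exact ⟨u, fun i j => by rw [hu, hu]; exact hpot i j⟩

end Weights

section Spectral

variable {A : Mat n} {r : ℝ} {W : List (Fin n)}

theorem finite_setOf_isCycle (R : Fin n → Fin n → Prop) : {W | IsCycle R W}.Finite := by
  refine (List.finite_length_le (Fin n) (n + 1)).subset fun W hW => ?_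
  have := hW.2.2.2.length_le_card
  rw [List.length_dropLast, Fintype.card_fin] at this
  change W.length ≤ n + 1
  omega

theorem mean_le_lam (hW : IsCycle (arc A) W) : mean A W ≤ lam A := by
  refine le_csSup ?_ ⟨W, hW, rfl⟩
  refine ((finite_setOf_isCycle (arc A)).image (mean A)).bddAbove.mono ?_
  rintro _ ⟨W, hW, rfl⟩
  exact ⟨W, hW, rfl⟩

theorem exists_weight_eq (hW : IsCycle (arc A) W) :
    ∃ w : ℝ, weight A W = w ∧ mean A W = ((w / len W : ℝ) : Rmax) := by
  obtain ⟨w, hw⟩ := WithBot.ne_bot_iff_exists.1 ((weight_ne_bot_iff A W).2 hW.2.1)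
  exact ⟨w, hw.symm, by rw [mean, ← hw]; rfl⟩

theorem weight_le_of_lam_eq (hr : lam A = r) (hW : IsCycle (arc A) W) :
    weight A W ≤ ((len W * r : ℝ) : Rmax) := by
  obtain ⟨w, hw, hm⟩ := exists_weight_eq hW
  have hle := mean_le_lam hW
  have hpos : (0 : ℝ) < len W := by exact_mod_cast hW.len_pos
  rw [hm, hr, WithBot.coe_le_coe, div_le_iff₀ hpos] at hle
  rw [hw, WithBot.coe_le_coe]
  linarith

theorem IsCritCycle.weight_eq (hr : lam A = r) (hW : IsCritCycle A W) :
    weight A W = ((len W * r : ℝ) : Rmax) := by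
  obtain ⟨w, hw, hm⟩ := exists_weight_eq hW.1
  have hpos : (0 : ℝ) < len W := by exact_mod_cast hW.1.len_pos
  have heq := hW.2
  rw [hm, hr, WithBot.coe_inj, div_eq_iff hpos.ne'] at heq
  rw [hw, heq, mul_comm]

theorem list_sum_nonpos_and_le {l : List Rmax} (hl : ∀ x ∈ l, x ≤ 0) :
    l.sum ≤ 0 ∧ ∀ y ∈ l, l.sum ≤ y := by
  induction l with
  | nil => simp
  | cons a l ih =>
    rw [List.forall_mem_cons] at hl
    obtain ⟨h0, hle⟩ := ih hl.2
    rw [List.sum_cons, List.forall_mem_cons]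
    exact ⟨add_nonpos hl.1 h0, add_le_of_nonpos_right h0,
      fun y hy => (add_le_of_nonpos_left hl.1).trans (hle y hy)⟩

/-- Every matrix with finite maximum cycle mean is, up to scaling, diagonally similar to a
nonpositive matrix whose critical arcs have weight zero. -/
theorem exists_normalization (hr : lam A = r) : ∃ (B : Mat n) (u : Fin n → ℝ),
    (∀ i j, A i j = B i j + ((r + u i - u j : ℝ) : Rmax)) ∧ (∀ i j, B i j ≤ 0) ∧
    ∀ i j, critArc A i j → 0 ≤ B i j := by
  let X : Mat n := fun i j => A i j + ((-r : ℝ) : Rmax)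
  have hAX : ∀ i j, A i j = X i j + ((r + (0 : Fin n → ℝ) i - (0 : Fin n → ℝ) j : ℝ) : Rmax) := by
    intro i j
    simp only [X, Pi.zero_apply]
    rw [add_assoc, ← WithBot.coe_add, show -r + (r + 0 - 0) = 0 by ring, WithBot.coe_zero,
      add_zero]
  have hcyc : ∀ W, IsCycle (arc X) W → weight X W ≤ 0 := by
    intro W hW
    have hWA : IsCycle (arc A) W :=
      ⟨hW.1, hW.2.1.imp fun a b hab hb => hab (by simp only [X, hb, WithBot.bot_add]), hW.2.2⟩
    obtain ⟨i, hi, -⟩ := hW.exists_walks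
    have hc := weight_conj hAX hi (hW.2.2.1 ▸ hi)
    have hle := weight_le_of_lam_eq hr hWA
    obtain ⟨w, hw⟩ := WithBot.ne_bot_iff_exists.1 ((weight_ne_bot_iff X W).2 hW.2.1)
    rw [hc, ← hw, ← WithBot.coe_add, WithBot.coe_le_coe] at hle
    rw [← hw, ← WithBot.coe_zero, WithBot.coe_le_coe]
    simpa using hle
  obtain ⟨u, hu⟩ := exists_potential hcyc
  let B : Mat n := fun i j => A i j + ((-r + u j - u i : ℝ) : Rmax)
  have hAB : ∀ i j, A i j = B i j + ((r + u i - u j : ℝ) : Rmax) := by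
    intro i j
    simp only [B]
    rw [add_assoc, ← WithBot.coe_add, show -r + u j - u i + (r + u i - u j) = 0 by ring,
      WithBot.coe_zero, add_zero]
  have hB : ∀ i j, B i j ≤ 0 := by
    intro i j
    have := add_le_add (hu i j) (le_refl ((-u i : ℝ) : Rmax))
    simp only [X] at this
    rw [add_assoc, add_assoc, ← WithBot.coe_add, ← WithBot.coe_add, ← WithBot.coe_add,
      add_neg_cancel, WithBot.coe_zero] at this
    refine le_of_eq_of_le ?_ this
    simp only [B]
    congr 2
    ring
  refine ⟨B, u, hAB, hB, ?_⟩
  rintro i j ⟨W, hW, hij⟩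
  obtain ⟨k, hk, -⟩ := hW.1.exists_walks
  have hc := weight_conj hAB hk (hW.1.2.2.1 ▸ hk)
  rw [hW.weight_eq hr, add_sub_cancel_right] at hc
  have h0 : weight B W = 0 := by
    have hne : weight B W ≠ ⊥ := fun hb => by
      rw [hb, WithBot.bot_add] at hc
      exact WithBot.coe_ne_bot hc
    obtain ⟨w, hw⟩ := WithBot.ne_bot_iff_exists.1 hne
    rw [← hw, ← WithBot.coe_add, WithBot.coe_inj] at hc
    rw [← hw, ← WithBot.coe_zero, WithBot.coe_inj]
    linarith
  rw [← h0]
  refine (list_sum_nonpos_and_le ?_).2 _ (List.mem_map.2 ⟨(i, j), hij, rfl⟩)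
  intro x hx
  obtain ⟨p, -, rfl⟩ := List.mem_map.1 hx
  exact hB _ _

end Spectral

section Critical

variable {A B : Mat n} {i j k x y : Fin n}

theorem IsCritCycle.isCycle_critArc {W : List (Fin n)} (hW : IsCritCycle A W) :
    IsCycle (critArc A) W :=
  hW.1.of_zip fun _ hp => ⟨W, hW, hp⟩

theorem critNode.onCycle (h : critNode A k) : onCycle (critArc A) k := by
  obtain ⟨W, hW, hk⟩ := h
  exact ⟨W, hW.isCycle_critArc, hk⟩

theorem critArc.right (h : critArc A x y) : critNode A y := by
  obtain ⟨W, hW, hxy⟩ := h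
  exact ⟨W, hW, List.mem_of_mem_tail (List.of_mem_zip hxy).2⟩

theorem critArc.sameSCC (h : critArc A x y) : sameSCC (critArc A) x y := by
  obtain ⟨W, hW, hxy⟩ := h
  obtain ⟨hx, hy⟩ := List.of_mem_zip hxy
  exact hW.isCycle_critArc.sameSCC hx (List.mem_of_mem_tail hy)

theorem HasWalk.critNode {t : ℕ} (h : HasWalk (critArc A) i j t) (hi : critNode A i) :
    critNode A j := by
  induction h with
  | refl => exact hi
  | step hr _ ih => exact ih hr.right

end Critical

section Sequences

variable {X : Mat n} {i j k : Fin n} {a b : ℕ}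

theorem exists_seq_of_pow_add_pow (h : pow X a i k + pow X b k j ≠ ⊥) :
    ∃ f : ℕ → Fin n, f 0 = i ∧ f a = k ∧ f (a + b) = j ∧
      pow X a i k + pow X b k j ≤ seqWeight X f (a + b) := by
  rw [ne_eq, WithBot.add_eq_bot, not_or] at h
  obtain ⟨f, hf0, hfa, hf⟩ := exists_pow_le_seqWeight X a i k h.1
  obtain ⟨f', hf0', hfb, hf'⟩ := exists_pow_le_seqWeight X b k j h.2
  have hF : ∀ s, (fun s => if s ≤ a then f s else f' (s - a)) (a + s) = f' s := by
    intro s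
    rcases Nat.eq_zero_or_pos s with rfl | hs
    · simp [hfa, hf0']
    · have : ¬ a + s ≤ a := by omega
      simp [this]
  refine ⟨fun s => if s ≤ a then f s else f' (s - a), by simp [hf0], by simp [hfa],
    (hF b).trans hfb, ?_⟩
  rw [seqWeight_add]
  refine add_le_add (hf.trans_eq ?_) (hf'.trans_eq ?_)
  · exact seqWeight_congr X fun s hs => (if_pos hs).symm
  · exact seqWeight_congr X fun s _ => (hF s).symm

theorem seqWeight_le_pow_add_pow (X : Mat n) (f : ℕ → Fin n) {s t : ℕ} (hs : s ≤ t) :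
    seqWeight X f t ≤ pow X s (f 0) (f s) + pow X (t - s) (f s) (f t) := by
  obtain ⟨d, rfl⟩ := Nat.exists_eq_add_of_le hs
  rw [seqWeight_add, Nat.add_sub_cancel_left]
  exact add_le_add (seqWeight_le_pow X f s) (seqWeight_le_pow X (fun x => f (s + x)) d)

end Sequences

/-- Restriction of a matrix to a set of nodes. -/
def restrict (X : Mat n) (U : Finset (Fin n)) : Mat n :=
  fun i j => if i ∈ U ∧ j ∈ U then X i j else ⊥

theorem restrict_le (X : Mat n) (U : Finset (Fin n)) (i j : Fin n) :
    restrict X U i j ≤ X i j := by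
  unfold restrict
  split_ifs
  · exact le_rfl
  · exact bot_le

theorem mem_of_restrict_ne_bot {X : Mat n} {U : Finset (Fin n)} {i j : Fin n}
    (h : restrict X U i j ≠ ⊥) : i ∈ U ∧ j ∈ U := by
  by_contra hU
  exact h (if_neg hU)

theorem seqWeight_restrict {X : Mat n} {U : Finset (Fin n)} {f : ℕ → Fin n} {t : ℕ}
    (h : ∀ s ≤ t, f s ∈ U) : seqWeight (restrict X U) f t = seqWeight X f t := by
  refine Finset.sum_congr rfl fun s hs => if_pos ?_
  rw [Finset.mem_range] at hs
  exact ⟨h s hs.le, h (s + 1) hs⟩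

/-- In a normalized matrix restricted to a set `U` of nodes containing a critical component,
walks through that component can be brought to any prescribed length of the right residue that
is at least the Dulmage–Mendelsohn bound. -/
theorem pow_add_pow_le_of_component {A B : Mat n} (hB : ∀ i j, B i j ≤ 0)
    (hcrit : ∀ i j, critArc A i j → 0 ≤ B i j) {U : Finset (Fin n)} {k : Fin n}
    (hk : critNode A k) (hU : ∀ v, critNode A v → sameSCC (critArc A) k v → v ∈ U)
    {a b t : ℕ} (hmod : a + b ≡ t [MOD cyclicity (critArc A)])
    (ht : DM (girthAt (critArc A) k) U.card ≤ t) (i j : Fin n) :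
    pow (restrict B U) a i k + pow (restrict B U) b k j ≤ pow (restrict B U) t i j := by
  set X := restrict B U with hXdef
  have hX : ∀ i j, X i j ≤ 0 := fun i j => (restrict_le B U i j).trans (hB i j)
  by_cases hbot : pow X a i k + pow X b k j = ⊥
  · rw [hbot]; exact bot_le
  obtain ⟨W, hW, ⟨v, hvW, hkv⟩, hg⟩ := exists_cycle_len_eq_girthAt hk.onCycle
  rw [← hg] at ht
  set g := len W
  have hg0 : 0 < g := hW.len_pos
  have hcomp : ∀ {p q s}, sameSCC (critArc A) k p → HasWalk (critArc A) p q s →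
      0 ≤ pow X s p q := by
    intro p q s hp hwalk
    refine (hwalk.of_closed (P := fun x => sameSCC (critArc A) k x)
      (fun x y hx hxy => hx.trans hxy.sameSCC) hp).pow_nonneg ?_
    rintro x y ⟨hxy, hx, hy⟩
    have hxU : x ∈ U := hU x (by
      obtain ⟨W, hW, hxy⟩ := hxy
      exact ⟨W, hW, (List.of_mem_zip hxy).1⟩) hx
    rw [hXdef, restrict, if_pos ⟨hxU, hU y hxy.right hy⟩]
    exact hcrit x y hxy
  obtain ⟨c, hkv'⟩ := reach_iff.1 hkv.1
  obtain ⟨d, hvk'⟩ := reach_iff.1 hkv.2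
  obtain ⟨e, he, hemod⟩ := exists_hasWalk_modEq hk.onCycle hg0
    (z := (t : ℤ) - (a + b : ℕ))
    ((Int.natCast_dvd_natCast.2 (sccGcd_dvd_cyclicity hk.onCycle)).trans
      (Nat.modEq_iff_dvd.1 hmod))
  have hkk : sameSCC (critArc A) k k := sameSCC_refl _ k
  have hback : HasWalk (critArc A) v k (d + (g - 1) * (c + d) + e) :=
    (hvk'.trans ((hkv'.trans hvk').repeat (g - 1))).trans he
  set a₁ := a + c
  set b₁ := d + (g - 1) * (c + d) + e + b
  have h₁ : pow X a i k + pow X b k j ≤ pow X a₁ i v + pow X b₁ v j := by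
    refine add_le_add ?_ ?_
    · exact (le_add_of_nonneg_right (hcomp hkk hkv')).trans (pow_add_pow_le X a c i k v)
    · exact (le_add_of_nonneg_left (hcomp hkv hback)).trans (pow_add_pow_le X _ b v k j)
  have hmod₁ : a₁ + b₁ ≡ t [MOD g] := by
    have h₂ : a₁ + b₁ = (a + b) + g * (c + d) + e := by
      obtain ⟨g', hg'⟩ := Nat.exists_eq_succ_of_ne_zero hg0.ne'
      simp only [a₁, b₁, hg', Nat.succ_eq_add_one, Nat.add_sub_cancel]
      ring
    rw [h₂, ← Int.natCast_modEq_iff]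
    have h₃ : (((a + b) + g * (c + d) + e : ℕ) : ℤ)
        ≡ ((a + b : ℕ) : ℤ) + 0 + (t - (a + b : ℕ)) [ZMOD g] := by
      rw [Nat.cast_add, Nat.cast_add]
      refine ((Int.ModEq.refl _).add ?_).add hemod
      rw [Nat.cast_mul]
      exact Int.modEq_zero_iff_dvd.2 (dvd_mul_right _ _)
    rwa [add_zero, add_sub_cancel] at h₃
  obtain ⟨f, hf0, hfa, hfb, hf⟩ := exists_seq_of_pow_add_pow (ne_bot_of_le_ne_bot hbot h₁)
  have hvia : IsVia X W.toFinset i j (pow X a i k + pow X b k j) g t f (a₁ + b₁) a₁ :=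
    ⟨hf0, hfb, Nat.le_add_right _ _, by rwa [hfa, List.mem_toFinset], hmod₁, h₁.trans hf⟩
  have hWU : W.toFinset ⊆ U := by
    intro w hw
    rw [List.mem_toFinset] at hw
    have hkw := hkv.trans (hW.sameSCC hvW hw)
    obtain ⟨s, hs⟩ := reach_iff.1 hkw.1
    exact hU w (hs.critNode hk) hkw
  obtain ⟨f', t', q', h', ht'⟩ := exists_short_isVia hX
    (fun _ _ h => mem_of_restrict_ne_bot h) hWU hg0 hW.len_le_card hbot hvia
  have hle : t' ≤ t := by
    by_contra hlt
    have hgt : t + g ≤ t' := by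
      have := Nat.le_of_dvd (by omega) ((Nat.modEq_iff_dvd' (by omega)).1 h'.modEq.symm)
      omega
    have hU1 : 1 ≤ U.card := Finset.card_pos.2 ⟨_, hWU (List.mem_toFinset.2 hvW)⟩
    unfold DM at ht
    have hmul : g * U.card ≤ g * (U.card - 2) + 2 * g := by
      rw [Nat.mul_comm 2 g, ← Nat.mul_add]
      exact Nat.mul_le_mul_left g (by omega)
    rcases hU1.eq_or_lt with h1 | h2
    · rw [← h1] at ht ht'
      omega
    · omega
  obtain ⟨m, hm⟩ := (Nat.modEq_iff_dvd' hle).1 h'.modEq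
  have hq'W : f' q' ∈ W := List.mem_toFinset.1 h'.mem
  have hpad : 0 ≤ pow X (m * g) (f' q') (f' q') :=
    hcomp (hkv.trans (hW.sameSCC hvW hq'W)) ((hW.hasWalk_self hq'W).repeat m)
  calc pow X a i k + pow X b k j ≤ seqWeight X f' t' := h'.le_weight
    _ ≤ pow X q' (f' 0) (f' q') + pow X (t' - q') (f' q') (f' t') :=
        seqWeight_le_pow_add_pow X f' h'.le_length
    _ ≤ pow X q' (f' 0) (f' q')
          + (pow X (m * g) (f' q') (f' q') + pow X (t' - q') (f' q') (f' t')) :=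
        add_le_add le_rfl (le_add_of_nonneg_left hpad)
    _ ≤ pow X q' (f' 0) (f' q') + pow X (m * g + (t' - q')) (f' q') (f' t') :=
        add_le_add le_rfl (pow_add_pow_le X _ _ _ _ _)
    _ ≤ pow X (q' + (m * g + (t' - q'))) (f' 0) (f' t') := pow_add_pow_le X _ _ _ _ _
    _ = pow X t i j := by
        rw [h'.head, h'.last]
        congr 1
        have := h'.le_length
        rw [Nat.mul_comm] at hm
        omega

section Components

variable {l : ℕ} {A B : Mat n} {N : Fin l → Finset (Fin n)} {g : Fin l → ℕ}

/-- In a normalized matrix, walks through critical nodes can be brought to any prescribed length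
of the right residue that is at least all the Dulmage–Mendelsohn bounds of the components. -/
theorem pow_add_pow_le_of_components (hcover : ∀ i, critNode A i ↔ ∃ ν, i ∈ N ν)
    (hdisj : ∀ ν μ, ν ≠ μ → Disjoint (N ν) (N μ))
    (hclass : ∀ ν, ∃ i, i ∈ N ν ∧
      ∀ j, (j ∈ N ν ↔ critNode A j ∧ sameSCC (critArc A) i j))
    (hgirth : ∀ ν, ∀ i ∈ N ν, girthAt (critArc A) i = g ν)
    (hB : ∀ i j, B i j ≤ 0) (hcrit : ∀ i j, critArc A i j → 0 ≤ B i j) {t : ℕ}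
    (ht : (Finset.univ.sup fun ν : Fin l =>
      DM (g ν) (n - ((Finset.univ.filter fun μ => μ < ν).biUnion N).card)) ≤ t)
    {k : Fin n} (hk : critNode A k) {a b : ℕ}
    (hmod : a + b ≡ t [MOD cyclicity (critArc A)]) (i j : Fin n) :
    pow B a i k + pow B b k j ≤ pow B t i j := by
  by_cases hbot : pow B a i k + pow B b k j = ⊥
  · rw [hbot]; exact bot_le
  obtain ⟨f, hf0, hfa, hfb, hf⟩ := exists_seq_of_pow_add_pow hbot
  obtain ⟨ν₀, hν₀⟩ := (hcover k).1 hk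
  obtain ⟨ν, ⟨s, hs, hsν⟩, hmin⟩ := WellFounded.has_min (wellFounded_lt (α := Fin l))
    {ν | ∃ s ≤ a + b, f s ∈ N ν} ⟨ν₀, a, Nat.le_add_right a b, by rwa [hfa]⟩
  set V := (Finset.univ.filter fun μ => μ < ν).biUnion N with hV
  have hmemV : ∀ v, v ∈ V ↔ ∃ μ < ν, v ∈ N μ := by simp [hV]
  have hfU : ∀ x ≤ a + b, f x ∈ Vᶜ := by
    intro x hx
    rw [Finset.mem_compl, hmemV]
    rintro ⟨μ, hμ, hxμ⟩
    exact hmin μ ⟨x, hx, hxμ⟩ hμ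
  have hcard : Vᶜ.card = n - V.card := by rw [Finset.card_compl, Fintype.card_fin]
  have hkν : ∀ v, critNode A v → sameSCC (critArc A) (f s) v → v ∈ Vᶜ := by
    intro v hv hsv
    obtain ⟨c, -, hc⟩ := hclass ν
    have hvν : v ∈ N ν := (hc v).2 ⟨hv, ((hc _).1 hsν).2.trans hsv⟩
    rw [Finset.mem_compl, hmemV]
    rintro ⟨μ, hμ, hvμ⟩
    exact Finset.disjoint_left.1 (hdisj μ ν hμ.ne) hvμ hvν
  have ht' : DM (girthAt (critArc A) (f s)) (Vᶜ).card ≤ t := by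
    rw [hgirth ν _ hsν, hcard]
    exact (Finset.le_sup (f := fun ν : Fin l =>
      DM (g ν) (n - ((Finset.univ.filter fun μ => μ < ν).biUnion N).card))
      (Finset.mem_univ ν)).trans ht
  rw [← Nat.add_sub_cancel' hs] at hmod
  rw [← seqWeight_restrict hfU] at hf
  refine hf.trans ((seqWeight_le_pow_add_pow _ f hs).trans ?_)
  rw [hf0, hfb]
  exact (pow_add_pow_le_of_component hB hcrit ((hcover _).2 ⟨ν, hsν⟩) hkν hmod ht' i j).trans
    (pow_mono (restrict_le B _) t i j)

end Components

section CSR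

variable {A B : Mat n} {u : Fin n → ℝ} {r : ℝ} {i j k m : Fin n} {t : ℕ}

/-- The Kleene star from which the factors `C` and `R` of the CSR terms are extracted. -/
def csrStar (A : Mat n) : Mat n :=
  star (pow (smul (negB (lam A)) A) (cyclicity (critArc A)))

/-- The middle factor `S` of the CSR terms. -/
def critPart (A : Mat n) : Mat n := fun i j => if critArc A i j then A i j else ⊥

theorem csr_eq_mul (h : lam A ≠ ⊥) (t : ℕ) :
    csr A t = mul (fun i j => if critNode A j then csrStar A i j else ⊥)
      (mul (pow (critPart A) t) fun i j => if critNode A i then csrStar A i j else ⊥) :=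
  if_neg h

theorem le_csr (h : lam A ≠ ⊥) (hk : critNode A k) (hm : critNode A m) :
    csrStar A i k + (pow (critPart A) t k m + csrStar A m j) ≤ csr A t i j := by
  rw [csr_eq_mul h]
  refine le_trans ?_ (le_mul_apply _ _ i k j)
  rw [if_pos hk]
  refine add_le_add le_rfl (le_trans ?_ (le_mul_apply _ _ k m j))
  rw [if_pos hm]

theorem csr_le (h : lam A ≠ ⊥) {c : Rmax} (hc : ∀ k m, critNode A k → critNode A m →
    csrStar A i k + (pow (critPart A) t k m + csrStar A m j) ≤ c) : csr A t i j ≤ c := by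
  rw [csr_eq_mul h]
  refine mul_apply_le fun k => ?_
  by_cases hk : critNode A k
  · obtain ⟨m, hm⟩ := exists_mul_apply_eq (pow (critPart A) t)
      (fun i j => if critNode A i then csrStar A i j else ⊥) k j
    rw [if_pos hk, hm]
    by_cases hm : critNode A m
    · rw [if_pos hm]; exact hc k m hk hm
    · rw [if_neg hm, WithBot.add_bot, WithBot.add_bot]; exact bot_le
  · rw [if_neg hk, WithBot.bot_add]; exact bot_le

theorem critPart_le (A : Mat n) (i j : Fin n) : critPart A i j ≤ A i j := by
  unfold critPart
  split_ifs
  · exact le_rfl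
  · exact bot_le

theorem smul_negB_lam (hr : lam A = r)
    (hAB : ∀ i j, A i j = B i j + ((r + u i - u j : ℝ) : Rmax)) (i j : Fin n) :
    smul (negB (lam A)) A i j = B i j + ((0 + u i - u j : ℝ) : Rmax) := by
  rw [smul, hr, hAB, add_left_comm]
  change _ + (((-r : ℝ) : Rmax) + _) = _
  rw [← WithBot.coe_add]
  congr 2
  ring

theorem exists_csrStar_eq (hr : lam A = r)
    (hAB : ∀ i j, A i j = B i j + ((r + u i - u j : ℝ) : Rmax)) (i j : Fin n) :
    ∃ x, csrStar A i j =
      pow B (cyclicity (critArc A) * x) i j + ((u i - u j : ℝ) : Rmax) := by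
  obtain ⟨x, -, hx⟩ := Finset.exists_mem_eq_sup (Finset.range n)
    ⟨0, Finset.mem_range.2 i.pos⟩
    fun x => pow (pow (smul (negB (lam A)) A) (cyclicity (critArc A))) x i j
  refine ⟨x, hx.trans ?_⟩
  rw [pow_pow, pow_conj (smul_negB_lam hr hAB), mul_zero, zero_add]

theorem pow_add_le_csrStar (hr : lam A = r)
    (hAB : ∀ i j, A i j = B i j + ((r + u i - u j : ℝ) : Rmax)) (hB : ∀ i j, B i j ≤ 0)
    (x : ℕ) (i j : Fin n) :
    pow B (cyclicity (critArc A) * x) i j + ((u i - u j : ℝ) : Rmax) ≤ csrStar A i j := by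
  obtain ⟨y, hy, hle⟩ := exists_lt_pow_le (pow_nonpos hB (cyclicity (critArc A))) x i j
  rw [pow_pow, pow_pow] at hle
  refine (add_le_add hle le_rfl).trans ?_
  refine le_trans (le_of_eq ?_) (Finset.le_sup (Finset.mem_range.2 hy))
  rw [pow_pow, pow_conj (smul_negB_lam hr hAB), mul_zero, zero_add]

theorem add_coe_add_coe (a b c : Rmax) {x y z w : ℝ} (h : x + (y + z) = w) :
    a + (x : Rmax) + (b + (y : Rmax) + (c + (z : Rmax))) = a + (b + c) + (w : Rmax) := by
  rw [← h, WithBot.coe_add, WithBot.coe_add]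
  abel

theorem csr_le_pow (hr : lam A = r)
    (hAB : ∀ i j, A i j = B i j + ((r + u i - u j : ℝ) : Rmax))
    (H : ∀ k, critNode A k → ∀ a b, a + b ≡ t [MOD cyclicity (critArc A)] →
      ∀ i j, pow B a i k + pow B b k j ≤ pow B t i j) (i j : Fin n) :
    csr A t i j ≤ pow A t i j := by
  refine csr_le (hr ▸ WithBot.coe_ne_bot) fun k m hk _ => ?_
  obtain ⟨x, hx⟩ := exists_csrStar_eq hr hAB i k
  obtain ⟨y, hy⟩ := exists_csrStar_eq hr hAB m j
  have hS := pow_mono (critPart_le A) t k m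
  rw [pow_conj hAB] at hS
  rw [hx, hy]
  refine (add_le_add le_rfl (add_le_add hS le_rfl)).trans ?_
  rw [add_coe_add_coe _ _ _ (w := t * r + u i - u j) (by ring), pow_conj hAB t i j]
  refine add_le_add ((add_le_add le_rfl (pow_add_pow_le B t _ k m j)).trans
    (H k hk _ _ ?_ i j)) le_rfl
  rw [Nat.add_left_comm, ← Nat.mul_add]
  exact Nat.add_modEq_left_iff.2 (dvd_mul_right _ _)

theorem pow_add_pow_le_csr (hr : lam A = r)
    (hAB : ∀ i j, A i j = B i j + ((r + u i - u j : ℝ) : Rmax)) (hB : ∀ i j, B i j ≤ 0)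
    (hcrit : ∀ i j, critArc A i j → 0 ≤ B i j) (hk : critNode A k) {a b : ℕ}
    (hmod : a + b ≡ t [MOD cyclicity (critArc A)]) (i j : Fin n) :
    pow B a i k + pow B b k j + ((t * r + u i - u j : ℝ) : Rmax) ≤ csr A t i j := by
  set γ := cyclicity (critArc A) with hγ
  have hγ0 : 0 < γ := cyclicity_pos _
  obtain ⟨W, hW, hkW⟩ := hk.onCycle
  have hW0 := hW.len_pos
  set c := (γ - 1) * a with hc
  have hca : a + c = γ * a := by
    obtain ⟨γ', hγ'⟩ := Nat.exists_eq_succ_of_ne_zero hγ0.ne'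
    rw [hc, hγ', Nat.succ_eq_add_one, Nat.add_sub_cancel]
    ring
  obtain ⟨d, hd⟩ := Nat.exists_eq_add_of_le
    (Nat.le_mul_of_pos_right (c + t) (Nat.mul_pos hγ0 hW0))
  have hclosed := (hW.hasWalk_self hkW).repeat ((c + t) * γ)
  rw [Nat.mul_assoc, hd, Nat.add_assoc] at hclosed
  obtain ⟨p, hkp, hpk⟩ := hclosed.split
  obtain ⟨q, hpq, hqk⟩ := hpk.split
  have hp := hkp.critNode hk
  have hq := hpq.critNode hp
  obtain ⟨y, hy⟩ : γ ∣ d + b := by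
    have h₁ := (Nat.modEq_iff_dvd.1 hmod.symm)
    rw [← Int.natCast_dvd_natCast]
    have h₂ : ((d + b : ℕ) : ℤ) = γ * ((c + t) * len W) + ((a + b : ℕ) - t) - γ * a := by
      zify at hd hca
      push_cast
      linarith
    rw [h₂]
    exact ((dvd_mul_right _ _).add h₁).sub (dvd_mul_right _ _)
  let S : Mat n := fun i j => if critArc A i j then B i j else ⊥
  have hS : ∀ i j, critPart A i j = S i j + ((r + u i - u j : ℝ) : Rmax) := by
    intro i j
    unfold critPart S
    split_ifs
    · exact hAB i j
    · rfl
  have hSpq : 0 ≤ pow S t p q := hpq.pow_nonneg fun x y hxy => by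
    unfold S
    rw [if_pos hxy]
    exact hcrit x y hxy
  have hleft : pow B a i k ≤ pow B (γ * a) i p := by
    rw [← hca]
    exact (le_add_of_nonneg_right (hkp.pow_nonneg hcrit)).trans (pow_add_pow_le B a c i k p)
  have hright : pow B b k j ≤ pow B (γ * y) q j := by
    rw [← hy]
    exact (le_add_of_nonneg_left (hqk.pow_nonneg hcrit)).trans (pow_add_pow_le B d b q k j)
  calc pow B a i k + pow B b k j + ((t * r + u i - u j : ℝ) : Rmax)
      ≤ pow B (γ * a) i p + (pow S t p q + pow B (γ * y) q j)
          + ((t * r + u i - u j : ℝ) : Rmax) :=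
        add_le_add (add_le_add hleft (hright.trans (le_add_of_nonneg_left hSpq))) le_rfl
    _ = pow B (γ * a) i p + ((u i - u p : ℝ) : Rmax)
          + (pow S t p q + ((t * r + u p - u q : ℝ) : Rmax)
            + (pow B (γ * y) q j + ((u q - u j : ℝ) : Rmax))) :=
        (add_coe_add_coe _ _ _ (by ring)).symm
    _ ≤ csrStar A i p + (pow (critPart A) t p q + csrStar A q j) := by
        rw [pow_conj hS]
        exact add_le_add (pow_add_le_csrStar hr hAB hB a i p)
          (add_le_add le_rfl (pow_add_le_csrStar hr hAB hB y q j))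
    _ ≤ csr A t i j := le_csr (hr ▸ WithBot.coe_ne_bot) hp hq

theorem bN_le (A : Mat n) (i j : Fin n) : bN A i j ≤ A i j := by
  unfold bN
  split_ifs
  · exact bot_le
  · exact le_rfl

theorem pow_le_oplus_csr (hr : lam A = r)
    (hAB : ∀ i j, A i j = B i j + ((r + u i - u j : ℝ) : Rmax)) (hB : ∀ i j, B i j ≤ 0)
    (hcrit : ∀ i j, critArc A i j → 0 ≤ B i j) (t : ℕ) (i j : Fin n) :
    pow A t i j ≤ oplus (csr A t) (pow (bN A) t) i j := by
  by_cases hbot : pow A t i j = ⊥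
  · rw [hbot]; exact bot_le
  obtain ⟨f, rfl, rfl, hf⟩ := exists_pow_le_seqWeight A t i j hbot
  refine hf.trans ?_
  by_cases hs : ∃ s ≤ t, critNode A (f s)
  · obtain ⟨s, hs, hsc⟩ := hs
    refine le_max_of_le_left ((seqWeight_le_pow_add_pow A f hs).trans ?_)
    refine le_trans (le_of_eq ?_) (pow_add_pow_le_csr hr hAB hB hcrit hsc
      (a := s) (b := t - s) (by rw [Nat.add_sub_cancel' hs]) _ _)
    rw [pow_conj hAB, pow_conj hAB, add_add_add_comm, ← WithBot.coe_add, Nat.cast_sub hs]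
    congr 2
    ring
  · push Not at hs
    refine le_max_of_le_right (le_trans (le_of_eq ?_) (seqWeight_le_pow (bN A) f t))
    refine Finset.sum_congr rfl fun s hst => (if_neg ?_).symm
    rw [Finset.mem_range] at hst
    exact not_or.2 ⟨hs s hst.le, hs (s + 1) hst⟩

theorem bN_eq_self (h : lam A = ⊥) : bN A = A := by
  have hnc : ∀ i, ¬ critNode A i := by
    rintro i ⟨W, hW, -⟩
    obtain ⟨w, -, hw⟩ := exists_weight_eq hW.1
    rw [hW.2, h] at hw
    exact WithBot.bot_ne_coe hw
  funext i j
  exact if_neg (not_or.2 ⟨hnc i, hnc j⟩)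

end CSR

end MaxPlus

namespace MaxPlus

/-- Proposition 4.4: if `C₁,…,C_l` are the strongly connected components of `C(A)`
with node sets `N₁,…,N_l` and girths `g₁,…,g_l`, and `n_ν = n - |N₁ ∪ ⋯ ∪ N_{ν-1}|`
is the dimension of the matrix `A^{(ν)}` obtained from `A` by zeroing the rows and
columns indexed by `N₁ ∪ ⋯ ∪ N_{ν-1}`, then `T₁(A) ≤ max_ν DM(g_ν, n_ν)`. -/
theorem T1_le_max_DM_scc {n l : ℕ} (A : Mat n) (N : Fin l → Finset (Fin n))
    (g : Fin l → ℕ)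
    -- the `N ν` cover exactly the critical nodes
    (hcover : ∀ i, critNode A i ↔ ∃ ν, i ∈ N ν)
    -- the `N ν` are pairwise disjoint
    (hdisj : ∀ ν μ, ν ≠ μ → Disjoint (N ν) (N μ))
    -- each `N ν` is the node set of a strongly connected component of `C(A)`
    (hclass : ∀ ν, ∃ i, i ∈ N ν ∧
      ∀ j, (j ∈ N ν ↔ critNode A j ∧ sameSCC (critArc A) i j))
    -- `g ν` is the girth of the component `C_ν`
    (hgirth : ∀ ν, ∀ i ∈ N ν, girthAt (critArc A) i = g ν) :
    T1 A ≤ Finset.univ.sup fun ν : Fin l =>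
      DM (g ν) (n - ((Finset.univ.filter fun μ => μ < ν).biUnion N).card) := by
  refine Nat.sInf_le fun t ht => ?_
  by_cases hbot : lam A = ⊥
  · funext i j
    have hcsr : csr A t i j = ⊥ := by rw [csr, if_pos hbot]
    rw [oplus, hcsr, bN_eq_self hbot, max_bot_left]
  obtain ⟨r, hr⟩ := WithBot.ne_bot_iff_exists.1 hbot
  obtain ⟨B, u, hAB, hB, hcrit⟩ := exists_normalization hr.symm
  funext i j
  refine le_antisymm (pow_le_oplus_csr hr.symm hAB hB hcrit t i j) (max_le ?_ ?_)
  · exact csr_le_pow hr.symm hAB (fun k hk a b hmod => pow_add_pow_le_of_components hcover hdisj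
      hclass hgirth hB hcrit ht hk hmod) i j
  · exact pow_mono (bN_le A) t i j

end MaxPlus
end
end

section
/- Let A ∈ ℝ_max^{2×2} with g(C(A)) = 2 (so both nodes lie on the unique critical cycle of length 2, i.e. 2·a_{11} < a_{12}+a_{21} and 2·a_{22} < a_{12}+a_{21}). Then T_1(A) = DM(2,2) = 2 if and only if a_{11} ≠ a_{22}. -/
open scoped Classical

noncomputable section

namespace MaxPlus

section Cycles

variable {R : Fin 2 → Fin 2 → Prop}

theorem IsCycle.eq_loop_or_eq_two_cycle {W : List (Fin 2)} (h : IsCycle R W) :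
    (∃ i, W = [i, i] ∧ R i i) ∨ ∃ i j, i ≠ j ∧ W = [i, j, i] ∧ R i j ∧ R j i := by
  obtain ⟨h2, hc, he, hn⟩ := h
  have hl := hn.length_le_card
  simp only [List.length_dropLast, Fintype.card_fin] at hl
  match W, h2, hc, he, hn, hl with
  | [i, j], _, hc, he, _, _ =>
    simp at he
    subst he
    exact Or.inl ⟨i, rfl, by simpa using (show List.IsChain R [i, i] from hc)⟩
  | [i, j, k], _, hc, he, hn, _ =>
    simp at he hn
    subst he
    exact Or.inr ⟨i, j, hn, rfl,
      by simpa using (show List.IsChain R [i, j, i] from hc)⟩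
  | _ :: _ :: _ :: _ :: _, _, _, _, _, hl => simp at hl

theorem isCycle_two_cycle {i j : Fin 2} (hij : i ≠ j) (h1 : R i j) (h2 : R j i) :
    IsCycle R [i, j, i] := by
  refine ⟨by simp, ?_, by simp, by simpa using hij⟩
  change List.IsChain R [i, j, i]
  simp [h1, h2]

theorem sccGcd_eq_two (hR : ∀ i j, R i j ↔ i ≠ j) (i : Fin 2) : sccGcd R i = 2 := by
  apply IsGreatest.csSup_eq
  constructor
  · intro W hW _
    rcases hW.eq_loop_or_eq_two_cycle with ⟨k, -, hk⟩ | ⟨k, l, -, rfl, -⟩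
    · exact absurd rfl ((hR k k).1 hk)
    · simp [len]
  · intro d hd
    have hi : i ≠ 1 - i := by fin_cases i <;> decide
    have hr : reach R i i := ⟨[i], ⟨by simp, List.isChain_singleton i⟩, rfl, rfl⟩
    exact Nat.le_of_dvd two_pos
      (hd _ (isCycle_two_cycle hi ((hR _ _).2 hi) ((hR _ _).2 hi.symm)) ⟨i, by simp, hr, hr⟩)

theorem cyclicity_eq_two (hR : ∀ i j, R i j ↔ i ≠ j) : cyclicity R = 2 := by
  have hc : ∀ i, onCycle R i := fun i ↦ by
    have hi : i ≠ 1 - i := by fin_cases i <;> decide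
    exact ⟨_, isCycle_two_cycle hi ((hR _ _).2 hi) ((hR _ _).2 hi.symm), by simp⟩
  have hf : sccGcd R = fun _ ↦ 2 := funext (sccGcd_eq_two hR)
  simp only [cyclicity, hc, hf]
  rfl

end Cycles

section Matrices

variable {n : ℕ}

/-- The `2 × 2` max-plus matrix with rows `(p, q)` and `(r, s)`. -/
def mat2 (p q r s : Rmax) : Mat 2 := ![![p, q], ![r, s]]

theorem eq_mat2 (A : Mat 2) : A = mat2 (A 0 0) (A 0 1) (A 1 0) (A 1 1) := by
  ext i j
  fin_cases i <;> fin_cases j <;> rfl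

theorem mul_mat2 (p q r s p' q' r' s' : Rmax) :
    mul (mat2 p q r s) (mat2 p' q' r' s') =
      mat2 (max (p + p') (q + r')) (max (p + q') (q + s'))
        (max (r + p') (s + r')) (max (r + q') (s + s')) := by
  ext i j
  fin_cases i <;> fin_cases j <;>
    simp [mul, mat2, Fin.univ_succ]

theorem smul_mat2 (x p q r s : Rmax) :
    smul x (mat2 p q r s) = mat2 (x + p) (x + q) (x + r) (x + s) := by
  ext i j
  fin_cases i <;> fin_cases j <;> rfl

theorem oplus_mat2 (p q r s p' q' r' s' : Rmax) :
    oplus (mat2 p q r s) (mat2 p' q' r' s') =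
      mat2 (max p p') (max q q') (max r r') (max s s') := by
  ext i j
  fin_cases i <;> fin_cases j <;> rfl

theorem idm_two : idm = mat2 0 ⊥ ⊥ 0 := by
  ext i j
  fin_cases i <;> fin_cases j <;> rfl

theorem pow_one_two (A : Mat 2) : pow A 1 = A := by
  rw [pow, pow, idm_two, eq_mat2 A, mul_mat2]
  simp

theorem pow_two_eq_mul_self (A : Mat 2) : pow A 2 = mul A A := by
  rw [pow, pow_one_two]

theorem star_two (A : Mat 2) : star A = oplus idm A := by
  ext i j
  have h := congr_fun₂ (pow_one_two A) i j
  simp only [star, oplus, Finset.range_add_one, Finset.range_zero, Finset.sup_insert, h]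
  simp [pow, max_comm]

theorem mul_smul_right (x : Rmax) (A B : Mat n) : mul A (smul x B) = smul x (mul A B) := by
  ext i j
  rcases Nat.eq_zero_or_pos n with rfl | hn
  · exact i.elim0
  have : Nonempty (Fin n) := ⟨i⟩
  simp only [mul, smul]
  rw [Finset.apply_sup_eq_sup_comp (fun y : Rmax ↦ x + y) (fun y z ↦ add_max x y z) (by simp)]
  simp only [Function.comp_def, add_left_comm]

theorem mul_smul_left (x : Rmax) (A B : Mat n) : mul (smul x A) B = smul x (mul A B) := by
  ext i j
  simp only [mul, smul]
  rw [Finset.apply_sup_eq_sup_comp (fun y : Rmax ↦ x + y) (fun y z ↦ add_max x y z) (by simp)]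
  simp only [Function.comp_def, add_assoc]

/-- If `A ^ (k + 2) = x ⊗ A ^ k`, the same relation holds at every later exponent. -/
theorem pow_add_two_eq_smul {A : Mat n} {x : Rmax} {k : ℕ}
    (h : pow A (k + 2) = smul x (pow A k)) (t : ℕ) (ht : k ≤ t) :
    pow A (t + 2) = smul x (pow A t) := by
  induction t, ht using Nat.le_induction with
  | base => exact h
  | succ t _ ih =>
    change mul A (pow A (t + 2)) = smul x (mul A (pow A t))
    rw [ih, mul_smul_right]

theorem pow_bot_succ (t : ℕ) : pow (fun _ _ ↦ ⊥ : Mat n) (t + 1) = fun _ _ ↦ ⊥ := by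
  ext i j
  simp [pow, mul]

end Matrices

section TwoCycleCritical

variable {a d : Rmax} {b c : ℝ}

theorem lam_eq (ha : 2 • a < ((b + c : ℝ) : Rmax)) (hd : 2 • d < ((b + c : ℝ) : Rmax)) :
    lam (mat2 a b c d) = (((b + c) / 2 : ℝ) : Rmax) ∧
      ∀ i, mean (mat2 a b c d) [i, i] ≠ lam (mat2 a b c d) := by
  have hloop : ∀ i, mean (mat2 a b c d) [i, i] < (((b + c) / 2 : ℝ) : Rmax) := by
    intro i
    fin_cases i
    · induction a using WithBot.recBotCoe with
      | bot => simp [mean, weight, mat2]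
      | coe a =>
        simp [mean, weight, mat2, len]
        norm_cast at ha ⊢
        simp at ha
        linarith
    · induction d using WithBot.recBotCoe with
      | bot => simp [mean, weight, mat2]
      | coe d =>
        simp [mean, weight, mat2, len]
        norm_cast at hd ⊢
        simp at hd
        linarith
  have htwo : ∀ i j, i ≠ j →
      mean (mat2 a b c d) [i, j, i] = (((b + c) / 2 : ℝ) : Rmax) := by
    intro i j hij
    fin_cases i <;> fin_cases j <;> simp at hij <;>
      simp [mean, weight, mat2, len, ← WithBot.coe_add, add_comm]
  have hlam : lam (mat2 a b c d) = (((b + c) / 2 : ℝ) : Rmax) := by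
    apply IsGreatest.csSup_eq
    constructor
    · exact ⟨[0, 1, 0], isCycle_two_cycle (by simp) (by simp [arc, mat2]) (by simp [arc, mat2]),
        (htwo 0 1 (by simp)).symm⟩
    · rintro _ ⟨W, hW, rfl⟩
      rcases hW.eq_loop_or_eq_two_cycle with ⟨k, rfl, -⟩ | ⟨k, l, hkl, rfl, -⟩
      · exact (hloop k).le
      · exact (htwo k l hkl).le
  exact ⟨hlam, fun i ↦ hlam ▸ (hloop i).ne⟩

theorem isCritCycle_iff (ha : 2 • a < ((b + c : ℝ) : Rmax)) (hd : 2 • d < ((b + c : ℝ) : Rmax))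
    (W : List (Fin 2)) :
    IsCritCycle (mat2 a b c d) W ↔ W = [0, 1, 0] ∨ W = [1, 0, 1] := by
  obtain ⟨hlam, hloop⟩ := lam_eq ha hd
  constructor
  · rintro ⟨hW, hm⟩
    rcases hW.eq_loop_or_eq_two_cycle with ⟨k, rfl, -⟩ | ⟨k, l, hkl, rfl, -⟩
    · exact absurd hm (hloop k)
    · fin_cases k <;> fin_cases l <;> simp at hkl ⊢
  · rintro (rfl | rfl)
    all_goals
      refine ⟨isCycle_two_cycle (by simp) (by simp [arc, mat2]) (by simp [arc, mat2]), ?_⟩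
      rw [hlam]
      simp [mean, weight, mat2, len, ← WithBot.coe_add, add_comm]

theorem critNode_mat2 (ha : 2 • a < ((b + c : ℝ) : Rmax)) (hd : 2 • d < ((b + c : ℝ) : Rmax))
    (i : Fin 2) : critNode (mat2 a b c d) i :=
  ⟨[0, 1, 0], (isCritCycle_iff ha hd _).2 (Or.inl rfl), by fin_cases i <;> simp⟩

theorem critArc_mat2 (ha : 2 • a < ((b + c : ℝ) : Rmax)) (hd : 2 • d < ((b + c : ℝ) : Rmax))
    (i j : Fin 2) : critArc (mat2 a b c d) i j ↔ i ≠ j := by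
  simp only [critArc, isCritCycle_iff ha hd]
  constructor
  · rintro ⟨W, rfl | rfl, h⟩ <;> fin_cases i <;> fin_cases j <;> simp at h ⊢
  · intro h
    refine ⟨[0, 1, 0], Or.inl rfl, ?_⟩
    fin_cases i <;> fin_cases j <;> simp at h ⊢

theorem pow_bN_mat2 (ha : 2 • a < ((b + c : ℝ) : Rmax)) (hd : 2 • d < ((b + c : ℝ) : Rmax))
    (t : ℕ) : pow (bN (mat2 a b c d)) (t + 1) = fun _ _ ↦ ⊥ := by
  have : bN (mat2 a b c d) = fun _ _ ↦ ⊥ := by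
    ext i j
    simp [bN, critNode_mat2 ha hd]
  rw [this, pow_bot_succ]

theorem two_nsmul_max_lt (ha : 2 • a < ((b + c : ℝ) : Rmax))
    (hd : 2 • d < ((b + c : ℝ) : Rmax)) : 2 • max a d < ((b + c : ℝ) : Rmax) := by
  rcases max_choice a d with h | h <;> rwa [h]

theorem pow_two_mat2 (ha : 2 • a < ((b + c : ℝ) : Rmax)) (hd : 2 • d < ((b + c : ℝ) : Rmax)) :
    pow (mat2 a b c d) 2 =
      mat2 ((b + c : ℝ) : Rmax) (b + max a d) (c + max a d) ((b + c : ℝ) : Rmax) := by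
  rw [two_nsmul] at ha hd
  rw [pow_two_eq_mul_self, mul_mat2, add_max, add_max, add_comm a b, add_comm d c,
    ← WithBot.coe_add, ← WithBot.coe_add, max_eq_right ha.le, add_comm c b, max_eq_left hd.le]

/-- The Kleene star of the normalised square. -/
theorem star_normalized (ha : 2 • a < ((b + c : ℝ) : Rmax))
    (hd : 2 • d < ((b + c : ℝ) : Rmax)) :
    star (pow (smul (negB (lam (mat2 a b c d))) (mat2 a b c d)) 2) =
      mat2 0 (((-c : ℝ) : Rmax) + max a d) (((-b : ℝ) : Rmax) + max a d) 0 := by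
  have hneg : negB (lam (mat2 a b c d)) = ((-((b + c) / 2) : ℝ) : Rmax) := by
    rw [(lam_eq ha hd).1]
    rfl
  rw [hneg, star_two, pow_two_eq_mul_self, mul_smul_left, mul_smul_right, ← pow_two_eq_mul_self,
    pow_two_mat2 ha hd, smul_mat2, smul_mat2, idm_two, oplus_mat2]
  simp only [← add_assoc, ← WithBot.coe_add]
  have h1 : -((b + c) / 2) + -((b + c) / 2) + b = -c := by ring
  have h2 : -((b + c) / 2) + -((b + c) / 2) + c = -b := by ring
  simp [h1, h2]

theorem csr_mat2 (ha : 2 • a < ((b + c : ℝ) : Rmax)) (hd : 2 • d < ((b + c : ℝ) : Rmax))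
    (t : ℕ) :
    csr (mat2 a b c d) t =
      mul (mat2 0 (((-c : ℝ) : Rmax) + max a d) (((-b : ℝ) : Rmax) + max a d) 0)
        (mul (pow (mat2 ⊥ b c ⊥) t)
          (mat2 0 (((-c : ℝ) : Rmax) + max a d) (((-b : ℝ) : Rmax) + max a d) 0)) := by
  have hS : (fun i j ↦ if i ≠ j then mat2 a b c d i j else ⊥) = mat2 ⊥ b c ⊥ := by
    ext i j
    fin_cases i <;> fin_cases j <;> simp [mat2]
  have hl : lam (mat2 a b c d) ≠ ⊥ := by simp [(lam_eq ha hd).1]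
  simp only [csr, if_neg hl, critNode_mat2 ha hd, critArc_mat2 ha hd, if_true,
    cyclicity_eq_two (critArc_mat2 ha hd), star_normalized ha hd, hS]

theorem csr_add_two (ha : 2 • a < ((b + c : ℝ) : Rmax)) (hd : 2 • d < ((b + c : ℝ) : Rmax))
    (t : ℕ) :
    csr (mat2 a b c d) (t + 2) = smul ((b + c : ℝ) : Rmax) (csr (mat2 a b c d) t) := by
  have hS : pow (mat2 ⊥ b c ⊥) 2 = smul ((b + c : ℝ) : Rmax) (pow (mat2 ⊥ b c ⊥) 0) := by
    rw [pow_two_eq_mul_self, mul_mat2, pow, idm_two, smul_mat2]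
    simp [add_comm]
  rw [csr_mat2 ha hd, csr_mat2 ha hd, pow_add_two_eq_smul hS t t.zero_le, mul_smul_left,
    mul_smul_right]

theorem csr_zero (ha : 2 • a < ((b + c : ℝ) : Rmax)) (hd : 2 • d < ((b + c : ℝ) : Rmax)) :
    csr (mat2 a b c d) 0 =
      mat2 0 (((-c : ℝ) : Rmax) + max a d) (((-b : ℝ) : Rmax) + max a d) 0 := by
  have hm := two_nsmul_max_lt ha hd
  rw [csr_mat2 ha hd, pow, idm_two, mul_mat2, mul_mat2]
  generalize max a d = m at hm ⊢
  induction m using WithBot.recBotCoe with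
  | bot => simp
  | coe m =>
    norm_cast at hm
    simp at hm
    have h1 : -c + m + (-b + m) ≤ 0 := by linarith
    have h2 : -b + m + (-c + m) ≤ 0 := by linarith
    simp [← WithBot.coe_add, ← WithBot.coe_zero, max_eq_left (WithBot.coe_le_coe.2 h1),
      max_eq_right (WithBot.coe_le_coe.2 h2)]

theorem csr_one (ha : 2 • a < ((b + c : ℝ) : Rmax)) (hd : 2 • d < ((b + c : ℝ) : Rmax)) :
    csr (mat2 a b c d) 1 = mat2 (max a d) b c (max a d) := by
  have hm := two_nsmul_max_lt ha hd
  rw [csr_mat2 ha hd, pow_one_two, mul_mat2, mul_mat2]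
  generalize max a d = m at hm ⊢
  induction m using WithBot.recBotCoe with
  | bot => simp
  | coe m =>
    norm_cast at hm
    simp at hm
    have h1 : -c + m + m ≤ b := by linarith
    have h2 : -b + m + m ≤ c := by linarith
    simp [← WithBot.coe_add, h1, h2]

theorem add_max_lt (ha : 2 • a < ((b + c : ℝ) : Rmax)) (hd : 2 • d < ((b + c : ℝ) : Rmax)) :
    a + max a d ≤ (b : Rmax) + c ∧ d + max a d ≤ (b : Rmax) + c := by
  have hm := two_nsmul_max_lt ha hd
  rw [two_nsmul, WithBot.coe_add] at hm
  exact ⟨(add_le_add_left (le_max_left a d) _).trans hm.le,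
    (add_le_add_left (le_max_right a d) _).trans hm.le⟩

theorem csr_two (ha : 2 • a < ((b + c : ℝ) : Rmax)) (hd : 2 • d < ((b + c : ℝ) : Rmax)) :
    csr (mat2 a b c d) 2 =
      mat2 ((b + c : ℝ) : Rmax) (b + max a d) (c + max a d) ((b + c : ℝ) : Rmax) := by
  rw [csr_add_two ha hd 0, csr_zero ha hd, smul_mat2]
  simp only [← add_assoc, ← WithBot.coe_add]
  simp

theorem mul_csr (ha : 2 • a < ((b + c : ℝ) : Rmax)) (hd : 2 • d < ((b + c : ℝ) : Rmax))
    (t : ℕ) :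
    mul (mat2 a b c d) (csr (mat2 a b c d) (t + 1)) = csr (mat2 a b c d) (t + 2) := by
  obtain ⟨ham, hdm⟩ := add_max_lt ha hd
  induction t using Nat.twoStepInduction with
  | zero =>
    rw [csr_two ha hd, csr_one ha hd, mul_mat2, WithBot.coe_add, add_comm (c : Rmax) b,
      add_comm a (b : Rmax), add_comm d (c : Rmax), ← add_max, ← add_max, max_eq_right ham,
      max_eq_left hdm, max_eq_right (le_max_left a d), max_eq_left (le_max_right a d)]
  | one =>
    rw [csr_add_two ha hd 1, csr_two ha hd, csr_one ha hd, mul_mat2, smul_mat2, WithBot.coe_add]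
    congr 1
    · rw [add_comm a, ← add_assoc, ← add_max, max_eq_right (le_max_left a d)]
    · rw [add_left_comm, ← add_max, max_eq_right ham, add_comm]
    · rw [add_left_comm d, ← add_max, max_eq_left hdm, add_comm]
    · rw [add_left_comm, ← add_assoc, add_comm d, ← add_max, max_eq_left (le_max_right a d)]
  | more t ih _ => rw [csr_add_two ha hd (t + 1), mul_smul_right, ih, csr_add_two ha hd (t + 2)]

theorem pow_eq_csr (ha : 2 • a < ((b + c : ℝ) : Rmax)) (hd : 2 • d < ((b + c : ℝ) : Rmax))
    (t : ℕ) : pow (mat2 a b c d) (t + 2) = csr (mat2 a b c d) (t + 2) := by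
  induction t with
  | zero => rw [pow_two_mat2 ha hd, csr_two ha hd]
  | succ t ih => rw [pow, ih, mul_csr ha hd]

theorem pow_eq_oplus_iff (ha : 2 • a < ((b + c : ℝ) : Rmax))
    (hd : 2 • d < ((b + c : ℝ) : Rmax)) (t : ℕ) :
    pow (mat2 a b c d) (t + 1) =
        oplus (csr (mat2 a b c d) (t + 1)) (pow (bN (mat2 a b c d)) (t + 1)) ↔
      pow (mat2 a b c d) (t + 1) = csr (mat2 a b c d) (t + 1) := by
  have h (B : Mat 2) : oplus B (fun _ _ ↦ ⊥) = B := by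
    ext i j
    simp [oplus]
  rw [pow_bN_mat2 ha hd, h]

theorem T1_mat2_eq_two_iff (ha : 2 • a < ((b + c : ℝ) : Rmax))
    (hd : 2 • d < ((b + c : ℝ) : Rmax)) : T1 (mat2 a b c d) = 2 ↔ a ≠ d := by
  set P := {T | ∀ t, T ≤ t → pow (mat2 a b c d) t =
    oplus (csr (mat2 a b c d) t) (pow (bN (mat2 a b c d)) t)}
  have h2 : 2 ∈ P := by
    intro t ht
    obtain ⟨t, rfl⟩ := Nat.exists_eq_add_of_le' ht
    exact (pow_eq_oplus_iff ha hd (t + 1)).2 (pow_eq_csr ha hd t)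
  have h1 : pow (mat2 a b c d) 1 = csr (mat2 a b c d) 1 ↔ a = d := by
    rw [pow_one_two, csr_one ha hd]
    constructor
    · intro h
      exact (congr_fun₂ h 0 0).trans (congr_fun₂ h 1 1).symm
    · rintro rfl
      rw [max_self]
  change sInf P = 2 ↔ _
  constructor
  · rintro h rfl
    have : 1 ∈ P := by
      intro t ht
      rcases ht.eq_or_lt with rfl | ht
      · exact (pow_eq_oplus_iff ha hd 0).2 (h1.2 rfl)
      · exact h2 t ht
    have := Nat.sInf_le this
    omega
  · intro h
    refine le_antisymm (Nat.sInf_le h2) (not_lt.1 fun hlt ↦ h (h1.1 ?_))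
    exact (pow_eq_oplus_iff ha hd 0).1 (Nat.sInf_mem ⟨2, h2⟩ 1 (Nat.lt_succ_iff.1 hlt))

end TwoCycleCritical

end MaxPlus

namespace MaxPlus

/-- Proposition 4.8: for a `2 × 2` matrix `A` with `g(C(A)) = 2` (so that both nodes lie
on the unique critical cycle of length 2, i.e. `2·a₁₁ < a₁₂ + a₂₁` and
`2·a₂₂ < a₁₂ + a₂₁`), one has `T₁(A) = DM(2,2) = 2` if and only if `a₁₁ ≠ a₂₂`. -/
theorem T1_two_by_two (A : Mat 2) (hg : maxGirth (critArc A) = 2)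
    (h11 : 2 • A 0 0 < A 0 1 + A 1 0) (h22 : 2 • A 1 1 < A 0 1 + A 1 0) :
    DM 2 2 = 2 ∧ (T1 A = DM 2 2 ↔ A 0 0 ≠ A 1 1) := by
  refine ⟨rfl, ?_⟩
  change T1 A = 2 ↔ _
  rw [eq_mat2 A]
  change T1 (mat2 (A 0 0) (A 0 1) (A 1 0) (A 1 1)) = 2 ↔ A 0 0 ≠ A 1 1
  have hne : A 0 1 + A 1 0 ≠ ⊥ := ne_bot_of_gt h11
  obtain ⟨hb, hc⟩ := WithBot.add_ne_bot.1 hne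
  obtain ⟨b, hb⟩ := WithBot.ne_bot_iff_exists.1 hb
  obtain ⟨c, hc⟩ := WithBot.ne_bot_iff_exists.1 hc
  rw [← hb, ← hc] at h11 h22 ⊢
  exact T1_mat2_eq_two_iff h11 h22

end MaxPlus
end
end
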